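/- Let F be the free group on a set S, let w ∈ F, and let G = F/⟪w⟫ be a one-relator group. The following are equivalent: (1) G is residually ℚ-solvable; (2) D^n(G) is a free group for some integer n ≥ 0; (3) whenever r ∈ F has reduced length at most that of w and k ≥ 1 is an integer with w ∈ r^k·[⟪r⟫, ⟪r⟫], the element w is conjugate in F to r or to r⁻¹. -/

import Mathlib

def ratDerived (G : Type*) [Group G] : ℕ → Subgroup G
  | 0 => ⊤
  | i + 1 =>
      Subgroup.closure
        {g | g ∈ ratDerived G i ∧
          ∃ k : ℕ, 1 ≤ k ∧ g ^ k ∈ ⁅ratDerived G i, ratDerived G i⁆}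

instance ratDerived_normal (G : Type*) [Group G] (i : ℕ) : (ratDerived G i).Normal := by
  induction i with
  | zero =>
    show (⊤ : Subgroup G).Normal
    infer_instance
  | succ i ih =>
    haveI := ih
    constructor
    intro x hx g
    have himg : (fun y => g * y * g⁻¹) ''
        {y | y ∈ ratDerived G i ∧ ∃ k : ℕ, 1 ≤ k ∧ y ^ k ∈ ⁅ratDerived G i, ratDerived G i⁆} ⊆
        {y | y ∈ ratDerived G i ∧ ∃ k : ℕ, 1 ≤ k ∧ y ^ k ∈ ⁅ratDerived G i, ratDerived G i⁆} := by
      rintro _ ⟨y, ⟨hy, k, hk, hyk⟩, rfl⟩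
      refine ⟨ih.conj_mem y hy g, k, hk, ?_⟩
      rw [conj_pow]
      exact (Subgroup.commutator_normal _ _).conj_mem _ hyk g
    have hmap : (ratDerived G (i + 1)).map (MulAut.conj g).toMonoidHom ≤ ratDerived G (i + 1) := by
      show (Subgroup.closure _).map _ ≤ Subgroup.closure _
      rw [MonoidHom.map_closure]
      refine (Subgroup.closure_le _).2 (fun y hy => Subgroup.subset_closure (himg ?_))
      simpa using hy
    exact hmap ⟨x, hx, rfl⟩

def ratDerivedOmega (G : Type*) [Group G] : Subgroup G := ⨅ i, ratDerived G i

instance ratDerivedOmega_normal (G : Type*) [Group G] : (ratDerivedOmega G).Normal := by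
  constructor
  intro x hx g
  simp only [ratDerivedOmega, Subgroup.mem_iInf] at hx ⊢
  exact fun i => (ratDerived_normal G i).conj_mem x (hx i) g

def QSolvable (G : Type*) [Group G] : Prop := ∃ n : ℕ, ratDerived G n = ⊥

def ResiduallyQSolvable (G : Type*) [Group G] : Prop := ratDerivedOmega G = ⊥

namespace OneRelator

universe u

variable {α : Type u} {Q : Type*} [Group Q]

/-- The element of the free group given by a signed letter. -/
def letter (p : α × Bool) : FreeGroup α := FreeGroup.mk [p]

/-- The inverse of a signed letter. -/
def inv (p : α × Bool) : α × Bool := (p.1, !p.2)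

/-- The product of the first `n` letters of a sequence. -/
def path (a : ℕ → α × Bool) : ℕ → FreeGroup α
  | 0 => 1
  | n + 1 => path a n * letter (a n)

@[simp] lemma path_zero (a : ℕ → α × Bool) : path a 0 = 1 := rfl

lemma path_succ (a : ℕ → α × Bool) (n : ℕ) : path a (n + 1) = path a n * letter (a n) := rfl

lemma letter_inv (p : α × Bool) : letter (inv p) = (letter p)⁻¹ := by
  simp [letter, inv, FreeGroup.inv_mk, FreeGroup.invRev]

lemma inv_inv (p : α × Bool) : inv (inv p) = p := by simp [inv]

lemma letter_true (x : α) : letter (x, true) = FreeGroup.of x := rfl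

lemma letter_false (x : α) : letter (x, false) = (FreeGroup.of x)⁻¹ := letter_inv (x, true)

lemma path_add (a : ℕ → α × Bool) (m n : ℕ) :
    path a (m + n) = path a m * path (fun i => a (m + i)) n := by
  induction n with
  | zero => simp
  | succ n ih => rw [← add_assoc, path_succ, ih, path_succ, mul_assoc]

lemma path_add_period {a : ℕ → α × Bool} {n : ℕ} (h : ∀ i, a (i + n) = a i) (m : ℕ) :
    path a (n + m) = path a n * path a m := by
  rw [path_add]
  congr 2
  funext i
  rw [add_comm, h]

lemma path_mul_period {a : ℕ → α × Bool} {d : ℕ} (h : ∀ i, a (i + d) = a i) (k : ℕ) :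
    path a (d * k) = path a d ^ k := by
  induction k with
  | zero => simp
  | succ k ih => rw [mul_add, mul_one, add_comm, path_add_period h, ih, pow_succ']

lemma path_eq_mk (a : ℕ → α × Bool) (n : ℕ) :
    path a n = FreeGroup.mk ((List.range n).map a) := by
  induction n with
  | zero => rfl
  | succ n ih => rw [path_succ, ih, letter, FreeGroup.mul_mk, List.range_succ, List.map_append,
      List.map_singleton]

lemma path_ne_one {a : ℕ → α × Bool} (h : ∀ i, a (i + 1) ≠ inv (a i)) {n : ℕ} (hn : n ≠ 0) :
    path a n ≠ 1 := by
  classical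
  intro h1
  have hr : FreeGroup.IsReduced ((List.range n).map a) := by
    unfold FreeGroup.IsReduced
    rw [List.isChain_map, List.isChain_range]
    intro m hm h2
    by_contra h3
    refine h m (Prod.ext h2.symm ?_)
    simp only [inv]
    cases h4 : (a m).2 <;> cases h5 : (a (m + 1)).2 <;> simp_all
  have := (FreeGroup.isReduced_iff_reduce_eq.1 hr)
  rw [← FreeGroup.toWord_mk] at this
  rw [← path_eq_mk, h1, FreeGroup.toWord_one] at this
  exact hn (by simpa using congrArg List.length this.symm)

lemma norm_path_le [DecidableEq α] (a : ℕ → α × Bool) (n : ℕ) : (path a n).norm ≤ n := by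
  rw [path_eq_mk]
  exact FreeGroup.norm_mk_le.trans (by simp)

/-- Left translation on the free group on `α × Q`. -/
def shift : Q →* MulAut (FreeGroup (α × Q)) where
  toFun q := FreeGroup.freeGroupCongr (Equiv.prodCongr (Equiv.refl α) (Equiv.mulLeft q))
  map_one' := by
    ext x
    induction x using FreeGroup.induction_on <;> simp_all
  map_mul' p q := by
    ext x
    induction x using FreeGroup.induction_on <;> simp_all [mul_assoc, Prod.map]

@[simp] lemma shift_of (q : Q) (x : α × Q) :
    shift q (FreeGroup.of x) = FreeGroup.of (x.1, q * x.2) := by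
  simp [shift, Prod.map]

/-- The free group acting on the Cayley graph of `Q`, as a homomorphism to a semidirect product. -/
def lamHom (f : FreeGroup α →* Q) : FreeGroup α →* FreeGroup (α × Q) ⋊[shift] Q :=
  FreeGroup.lift fun x => ⟨FreeGroup.of (x, 1), f (FreeGroup.of x)⟩

/-- The lift of an element of the free group to a path from `1` in the Cayley graph of `Q`. -/
def lam (f : FreeGroup α →* Q) (g : FreeGroup α) : FreeGroup (α × Q) := (lamHom f g).left

lemma lamHom_right (f : FreeGroup α →* Q) (g : FreeGroup α) : (lamHom f g).right = f g := by
  have : SemidirectProduct.rightHom.comp (lamHom f) = f := by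
    ext x; simp [lamHom]
  exact DFunLike.congr_fun this g

@[simp] lemma lam_one (f : FreeGroup α →* Q) : lam f 1 = 1 := by simp [lam]

lemma lam_mul (f : FreeGroup α →* Q) (g h : FreeGroup α) :
    lam f (g * h) = lam f g * shift (f g) (lam f h) := by
  simp [lam, lamHom_right]

lemma lam_inv (f : FreeGroup α →* Q) (g : FreeGroup α) :
    lam f g⁻¹ = shift (f g)⁻¹ (lam f g)⁻¹ := by
  simp [lam, lamHom_right]

lemma lam_of (f : FreeGroup α →* Q) (x : α) :
    lam f (FreeGroup.of x) = FreeGroup.of (x, 1) := by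
  simp [lam, lamHom]

/-- The edge of the Cayley graph traversed from `q` by a signed letter. -/
def edge (f : FreeGroup α →* Q) (q : Q) (p : α × Bool) : α × Q :=
  (p.1, if p.2 then q else q * f (letter p))

lemma shift_letter (q : Q) (x : α × Q) (b : Bool) :
    shift q (letter (x, b)) = letter ((x.1, q * x.2), b) := by
  cases b
  · rw [letter_false, letter_false, map_inv, shift_of]
  · rw [letter_true, letter_true, shift_of]

lemma lam_letter (f : FreeGroup α →* Q) (p : α × Bool) :
    lam f (letter p) = letter (edge f 1 p, p.2) := by
  obtain ⟨x, b⟩ := p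
  cases b
  · rw [letter_false, lam_inv, lam_of, map_inv, shift_of]
    simp [letter_false, edge]
  · simp [letter_true, lam_of, edge]

lemma mul_edge (f : FreeGroup α →* Q) (q r : Q) (p : α × Bool) :
    edge f (q * r) p = ((edge f r p).1, q * (edge f r p).2) := by
  obtain ⟨x, b⟩ := p
  cases b <;> simp [edge, mul_assoc]

/-- The lift of a sequence of signed letters to the Cayley graph. -/
def lseq (f : FreeGroup α →* Q) (a : ℕ → α × Bool) (i : ℕ) : (α × Q) × Bool :=
  (edge f (f (path a i)) (a i), (a i).2)

lemma lam_path (f : FreeGroup α →* Q) (a : ℕ → α × Bool) (n : ℕ) :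
    lam f (path a n) = path (lseq f a) n := by
  induction n with
  | zero => simp
  | succ n ih =>
    rw [path_succ, lam_mul, ih, lam_letter, shift_letter, ← mul_edge, mul_one, path_succ]
    rfl

/-- Forgetting the vertex in the Cayley graph. -/
def collapse : FreeGroup (α × Q) →* FreeGroup α := FreeGroup.map Prod.fst

lemma collapse_shift (q : Q) (g : FreeGroup (α × Q)) : collapse (shift q g) = collapse g := by
  have : (collapse (α := α) (Q := Q)).comp (shift q).toMonoidHom = collapse := by
    ext x; simp [collapse]
  exact DFunLike.congr_fun this g

lemma collapse_lam (f : FreeGroup α →* Q) (g : FreeGroup α) : collapse (lam f g) = g := by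
  induction g using FreeGroup.induction_on with
  | C1 => simp
  | of x => simp [lam_of, collapse]
  | inv_of x h =>
    rw [lam_inv, collapse_shift, map_inv, h]
  | mul x y hx hy => rw [lam_mul, map_mul, collapse_shift, hx, hy]

lemma lseq_period (f : FreeGroup α →* Q) {a : ℕ → α × Bool} {n : ℕ} (h : ∀ i, a (i + n) = a i)
    (hf : f (path a n) = 1) (i : ℕ) : lseq f a (i + n) = lseq f a i := by
  rw [lseq, lseq, h, add_comm i n, path_add_period h, map_mul, hf, one_mul]

lemma lseq_reduced (f : FreeGroup α →* Q) {a : ℕ → α × Bool} (h : ∀ i, a (i + 1) ≠ inv (a i))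
    (i : ℕ) : lseq f a (i + 1) ≠ inv (lseq f a i) := by
  intro h1
  refine h i (Prod.ext ?_ ?_)
  · exact congrArg (fun p => p.1.1) h1
  · exact congrArg (fun p => p.2) h1

lemma lam_mem_closure (f : FreeGroup α →* Q) {T : Set α} {g : FreeGroup α}
    (hg : g ∈ Subgroup.closure (FreeGroup.of '' T)) (q : Q) :
    shift q (lam f g) ∈ Subgroup.closure (FreeGroup.of '' {p : α × Q | p.1 ∈ T}) := by
  induction hg using Subgroup.closure_induction generalizing q with
  | mem x hx =>
    obtain ⟨y, hy, rfl⟩ := hx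
    rw [lam_of, shift_of]
    exact Subgroup.subset_closure ⟨_, hy, rfl⟩
  | one => simp
  | mul x y _ _ hx hy =>
    rw [lam_mul, map_mul, ← MulAut.mul_apply, ← map_mul]
    exact Subgroup.mul_mem _ (hx q) (hy _)
  | inv x _ hx =>
    rw [lam_inv, map_inv, map_inv, ← MulAut.mul_apply, ← map_mul]
    exact Subgroup.inv_mem _ (hx _)

open scoped Classical in
/-- The set of letters occurring among the first `n` terms of a sequence. -/
noncomputable def letters (a : ℕ → α × Bool) (n : ℕ) : Finset α :=
  (Finset.range n).image fun i => (a i).1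

lemma mem_letters {a : ℕ → α × Bool} {n : ℕ} {x : α} :
    x ∈ letters a n ↔ ∃ i < n, (a i).1 = x := by
  simp [letters]

lemma letter_mem {T : Set α} {p : α × Bool} (h : p.1 ∈ T) :
    letter p ∈ Subgroup.closure (FreeGroup.of '' T) := by
  obtain ⟨x, b⟩ := p
  have : FreeGroup.of x ∈ Subgroup.closure (FreeGroup.of '' T) :=
    Subgroup.subset_closure ⟨_, h, rfl⟩
  cases b
  · rw [letter_false]; exact Subgroup.inv_mem _ this
  · exact this

lemma path_mem {T : Set α} {a : ℕ → α × Bool} {n : ℕ} (h : ∀ i < n, (a i).1 ∈ T) :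
    path a n ∈ Subgroup.closure (FreeGroup.of '' T) := by
  induction n with
  | zero => exact Subgroup.one_mem _
  | succ n ih =>
    exact Subgroup.mul_mem _ (ih fun i hi => h i (by omega)) (letter_mem (h n (by omega)))

end OneRelator

namespace OneRelator

universe u

variable {α : Type u}

open Multiplicative

/-- The edges of `α × ℤ` whose level lies in an interval whenever their label is `s`. -/
def band (s : α) (μ M : ℤ) : Set (α × Multiplicative ℤ) :=
  {p | p.1 = s → μ ≤ toAdd p.2 ∧ toAdd p.2 ≤ M}

lemma shift_mem_closure {Q : Type*} [Group Q] {q : Q} {T T' : Set (α × Q)}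
    (h : ∀ p ∈ T, (p.1, q * p.2) ∈ T')
    {g : FreeGroup (α × Q)} (hg : g ∈ Subgroup.closure (FreeGroup.of '' T)) :
    shift q g ∈ Subgroup.closure (FreeGroup.of '' T') := by
  have : Subgroup.closure (FreeGroup.of '' T) ≤
      (Subgroup.closure (FreeGroup.of '' T')).comap (shift q).toMonoidHom := by
    rw [Subgroup.closure_le]
    rintro _ ⟨p, hp, rfl⟩
    refine Subgroup.subset_closure ⟨_, h p hp, ?_⟩
    simp
  exact this hg

lemma shift_mem_normalClosure {Q : Type*} [Group Q] (q : Q) {r g : FreeGroup (α × Q)}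
    (hg : g ∈ Subgroup.normalClosure {r}) :
    shift q g ∈ Subgroup.normalClosure {shift q r} := by
  have : Subgroup.normalClosure {r} ≤
      (Subgroup.normalClosure {shift q r}).comap (shift q).toMonoidHom := by
    refine Subgroup.normalClosure_le_normal ?_
    rintro _ rfl
    exact Subgroup.subset_normalClosure rfl
  exact this hg

lemma hnn_model (s : α) {μ M : ℤ} (w' : FreeGroup (α × Multiplicative ℤ))
    (hA : ∀ v ∈ Subgroup.normalClosure {w'},
      v ∈ Subgroup.closure (FreeGroup.of '' band s μ (M - 1)) → v = 1)
    (hB : ∀ v ∈ Subgroup.normalClosure {w'},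
      v ∈ Subgroup.closure (FreeGroup.of '' band s (μ + 1) M) → v = 1) :
    ∃ (H : Type u) (_ : Group H)
      (j : FreeGroup (α × Multiplicative ℤ) ⧸ Subgroup.normalClosure {w'} →* H) (t : H),
      Function.Injective j ∧ ∀ p ∈ band s μ (M - 1),
        j (QuotientGroup.mk' _ (FreeGroup.of (p.1, ofAdd 1 * p.2))) =
          t * j (QuotientGroup.mk' _ (FreeGroup.of p)) * t⁻¹ := by
  let N := Subgroup.normalClosure {w'}
  let Φ := Subgroup.closure (FreeGroup.of '' band s μ (M - 1))
  let ι : Φ →* FreeGroup (α × Multiplicative ℤ) ⧸ N := (QuotientGroup.mk' N).comp Φ.subtype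
  let ι' : Φ →* FreeGroup (α × Multiplicative ℤ) ⧸ N :=
    (QuotientGroup.mk' N).comp
      ((shift (ofAdd (1 : ℤ))).toMonoidHom.comp Φ.subtype)
  have hι : Function.Injective ι := by
    rw [injective_iff_map_eq_one]
    intro v hv
    exact Subtype.ext (hA v ((QuotientGroup.eq_one_iff _).1 hv) v.2)
  have hι' : Function.Injective ι' := by
    rw [injective_iff_map_eq_one]
    intro v hv
    have h1 := hB _ ((QuotientGroup.eq_one_iff _).1 hv)
      (shift_mem_closure (T := band s μ (M - 1)) ?_ v.2)
    · exact Subtype.ext ((map_eq_one_iff (shift (ofAdd (1 : ℤ))) (MulEquiv.injective _)).1 h1)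
    · intro p hp h
      have := hp h
      simp only [toAdd_mul, toAdd_ofAdd]
      omega
  let e : ι.range ≃* ι'.range :=
    (MonoidHom.ofInjective hι).symm.trans (MonoidHom.ofInjective hι')
  refine ⟨HNNExtension _ _ _ e, inferInstance, HNNExtension.of, HNNExtension.t,
    HNNExtension.of_injective _, ?_⟩
  intro p hp
  let v : Φ := ⟨FreeGroup.of p, Subgroup.subset_closure ⟨p, hp, rfl⟩⟩
  have h1 := HNNExtension.equiv_eq_conj (φ := e) (MonoidHom.ofInjective hι v)
  have h2 : e (MonoidHom.ofInjective hι v) = MonoidHom.ofInjective hι' v := by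
    simp [e]
  rw [h2] at h1
  have h3 : ((MonoidHom.ofInjective hι' v : ι'.range) : FreeGroup (α × Multiplicative ℤ) ⧸ N) =
      QuotientGroup.mk' N (FreeGroup.of (p.1, ofAdd 1 * p.2)) := by
    show QuotientGroup.mk' N (shift (ofAdd 1) (FreeGroup.of p)) = _
    rw [shift_of]
  rw [h3] at h1
  exact h1

/-- Elements of the normal closure of `w` which lift to a single band lie in the normal closure
of the lift of `w`. -/
lemma lift_mem_normalClosure (φ : FreeGroup α →* Multiplicative ℤ) {w : FreeGroup α}
    (hw : φ w = 1) (s : α) {μ M : ℤ} (hμ : μ ≤ M)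
    (hA : ∀ v ∈ Subgroup.normalClosure {lam φ w},
      v ∈ Subgroup.closure (FreeGroup.of '' band s μ (M - 1)) → v = 1)
    (hB : ∀ v ∈ Subgroup.normalClosure {lam φ w},
      v ∈ Subgroup.closure (FreeGroup.of '' band s (μ + 1) M) → v = 1)
    (hb : lam φ w ∈ Subgroup.closure (FreeGroup.of '' band s μ M))
    {v : FreeGroup α} (hv : v ∈ Subgroup.normalClosure {w}) (q : Multiplicative ℤ)
    (hvb : shift q (lam φ v) ∈ Subgroup.closure (FreeGroup.of '' band s μ M)) :
    shift q (lam φ v) ∈ Subgroup.normalClosure {lam φ w} := by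
  obtain ⟨H, _, j, t, hj, ht⟩ := hnn_model s (lam φ w) hA hB
  let N := Subgroup.normalClosure {lam φ w}
  let c (p : α × Multiplicative ℤ) : H := j (QuotientGroup.mk' N (FreeGroup.of p))
  let e (p : α × Multiplicative ℤ) : H :=
    t ^ (toAdd p.2) * (t ^ (-μ) * c (p.1, ofAdd μ) * t ^ μ) * t ^ (-(toAdd p.2))
  have ht' : ∀ (x : α) (i : ℤ), (x = s → μ ≤ i ∧ i ≤ M - 1) →
      c (x, ofAdd (i + 1)) = t * c (x, ofAdd i) * t⁻¹ := by
    intro x i hi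
    rw [add_comm, ofAdd_add]
    exact ht (x, ofAdd i) hi
  have he : ∀ p ∈ band s μ M, e p = c p := by
    rintro ⟨x, i⟩ hp
    obtain ⟨i, rfl⟩ := ofAdd.surjective i
    replace hp : x = s → μ ≤ i ∧ i ≤ M := hp
    have key : c (x, ofAdd i) =
        t ^ (i - μ) * c (x, ofAdd μ) * (t ^ (i - μ))⁻¹ := by
      rcases le_total μ i with hi | hi
      · have : ∀ n : ℕ, (x = s → μ + n ≤ M) → c (x, ofAdd (μ + n)) =
            t ^ n * c (x, ofAdd μ) * (t ^ n)⁻¹ := by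
          intro n
          induction n with
          | zero => intro; simp
          | succ n ih =>
            intro hn
            have h1 := ht' x (μ + n) fun h => ⟨by omega, by have := hn h; push_cast at this; omega⟩
            rw [ih fun h => by have := hn h; push_cast at this; omega] at h1
            push_cast
            rw [← add_assoc, h1, pow_succ']
            group
        obtain ⟨n, rfl⟩ := Int.le.dest hi
        simpa using this n fun h => (hp h).2
      · by_cases hx : x = s
        · have : i = μ := le_antisymm hi (hp hx).1
          subst this
          simp
        · have : ∀ n : ℕ, c (x, ofAdd (μ - n)) = (t ^ n)⁻¹ * c (x, ofAdd μ) * t ^ n := by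
            intro n
            induction n with
            | zero => simp
            | succ n ih =>
              have h1 := ht' x (μ - (n + 1)) fun h => absurd h hx
              rw [show μ - ((n : ℤ) + 1) + 1 = μ - n by ring, ih] at h1
              push_cast
              have h2 : ∀ y : H, y = t⁻¹ * (t * y * t⁻¹) * t := fun y => by group
              rw [h2 (c (x, ofAdd (μ - ((n : ℤ) + 1)))), ← h1, pow_succ]
              group
          obtain ⟨n, hn⟩ := Int.le.dest hi
          obtain rfl : i = μ - n := by omega
          simpa using this n
    rw [key]
    simp only [e, toAdd_ofAdd]
    rw [sub_eq_add_neg, zpow_add]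
    group
  let ehat : FreeGroup (α × Multiplicative ℤ) →* H := FreeGroup.lift e
  have hehat : ∀ g ∈ Subgroup.closure (FreeGroup.of '' band s μ M),
      ehat g = j (QuotientGroup.mk' N g) := by
    intro g hg
    induction hg using Subgroup.closure_induction with
    | mem x hx =>
      obtain ⟨p, hp, rfl⟩ := hx
      rw [FreeGroup.lift_apply_of, he p hp]
    | one => simp
    | mul x y _ _ hx hy => rw [map_mul, hx, hy, map_mul, map_mul]
    | inv x _ hx => rw [map_inv, hx, map_inv, map_inv]
  have hcomp : ∀ q : Multiplicative ℤ, ehat.comp (shift q).toMonoidHom =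
      (MulAut.conj (zpowersHom H t q)).toMonoidHom.comp ehat := by
    intro q
    have hz : ∀ x, (MulAut.conj t ^ toAdd q) x = t ^ toAdd q * x * (t ^ toAdd q)⁻¹ := by
      intro x
      rw [← map_zpow, MulAut.conj_apply]
    ext p
    simp [ehat, e, zpow_add, mul_assoc, hz]
  let Θ : FreeGroup α →* H :=
    (SemidirectProduct.lift ehat (zpowersHom H t) hcomp).comp (lamHom φ)
  have hΘ : ∀ g, φ g = 1 → Θ g = ehat (lam φ g) := by
    intro g hg
    show ehat (lam φ g) * zpowersHom H t (lamHom φ g).right = _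
    rw [lamHom_right, hg, map_one, mul_one]
  have hker : Subgroup.normalClosure {w} ≤ Θ.ker ⊓ φ.ker := by
    refine Subgroup.normalClosure_le_normal ?_
    rw [Set.singleton_subset_iff]
    refine ⟨?_, hw⟩
    show Θ _ = 1
    rw [hΘ _ hw, hehat _ hb]
    have : QuotientGroup.mk' N (lam φ w) = 1 :=
      (QuotientGroup.eq_one_iff _).2 (Subgroup.subset_normalClosure rfl)
    rw [this, map_one]
  obtain ⟨h1, h2⟩ := hker hv
  have h3 : ehat (shift q (lam φ v)) = 1 := by
    have := DFunLike.congr_fun (hcomp q) (lam φ v)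
    simp only [MonoidHom.comp_apply, MulEquiv.coe_toMonoidHom] at this
    rw [this, ← hΘ v h2, show Θ v = 1 from h1, map_one]
  rw [hehat _ hvb, map_eq_one_iff j hj] at h3
  exact (QuotientGroup.eq_one_iff _).1 h3

end OneRelator

namespace OneRelator

universe u

variable {α : Type u}

open Multiplicative

open scoped Classical in
/-- The exponent sum of a letter. -/
noncomputable def expSum (x : α) : FreeGroup α →* Multiplicative ℤ :=
  FreeGroup.lift fun y => if y = x then ofAdd 1 else 1

lemma expSum_letter_of_ne {x : α} {p : α × Bool} (h : p.1 ≠ x) : expSum x (letter p) = 1 := by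
  obtain ⟨y, b⟩ := p
  replace h : y ≠ x := h
  cases b <;> simp [letter_true, letter_false, expSum, h]

lemma expSum_letter_ne_one (p : α × Bool) : expSum p.1 (letter p) ≠ 1 := by
  obtain ⟨y, b⟩ := p
  cases b <;> simp [letter_true, letter_false, expSum, ← ofAdd_neg, ← ofAdd_zero]

lemma hom_path_eq {G : Type*} [Group G] (φ : FreeGroup α →* G) {a : ℕ → α × Bool} {i j : ℕ}
    (hij : i ≤ j) (h : ∀ q, i ≤ q → q < j → φ (letter (a q)) = 1) :
    φ (path a i) = φ (path a j) := by
  induction j, hij using Nat.le_induction with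
  | base => rfl
  | succ j hj ih =>
    rw [path_succ, map_mul, h j hj (by omega), mul_one]
    exact ih fun q h1 h2 => h q h1 (by omega)

lemma expSum_path_eq {x : α} {a : ℕ → α × Bool} {i j : ℕ} (hij : i ≤ j)
    (h : ∀ q, i ≤ q → q < j → (a q).1 ≠ x) : expSum x (path a i) = expSum x (path a j) :=
  hom_path_eq _ hij fun q h1 h2 => expSum_letter_of_ne (h q h1 h2)

lemma expSum_path_ne {a : ℕ → α × Bool} {i j p : ℕ} (hip : i ≤ p) (hpj : p < j)
    (h : ∀ q, i ≤ q → q < j → q ≠ p → (a q).1 ≠ (a p).1) :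
    expSum (a p).1 (path a i) ≠ expSum (a p).1 (path a j) := by
  have h1 : expSum (a p).1 (path a i) = expSum (a p).1 (path a p) :=
    expSum_path_eq hip fun q h1 h2 => h q h1 (by omega) (by omega)
  have h2 : expSum (a p).1 (path a (p + 1)) = expSum (a p).1 (path a j) :=
    expSum_path_eq hpj fun q h1 h2 => h q (by omega) h2 (by omega)
  rw [h1, ← h2, path_succ, map_mul]
  intro h3
  exact expSum_letter_ne_one _ (left_eq_mul.1 h3)

/-- A homomorphism to `ℤ` killing `w` separates two occurrences of a letter in the sequence. -/
def Splits (a : ℕ → α × Bool) (n : ℕ) (φ : FreeGroup α →* Multiplicative ℤ) : Prop :=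
  φ (path a n) = 1 ∧ ∃ i j, (a i).1 = (a j).1 ∧ (lseq φ a i).1 ≠ (lseq φ a j).1

lemma eq_or_eq_inv {p q : α × Bool} (h : p.1 = q.1) : p = q ∨ p = inv q := by
  obtain ⟨x, b⟩ := p
  obtain ⟨y, c⟩ := q
  obtain rfl : x = y := h
  cases b <;> cases c <;> simp [inv]

/-- If no homomorphism to `ℤ` splits a cyclically reduced periodic sequence then it is the
repetition of a word without repeated letters. -/
theorem exists_period_of_not_splits {a : ℕ → α × Bool} {n : ℕ} (hn : n ≠ 0)
    (hp : ∀ i, a (i + n) = a i) (hr : ∀ i, a (i + 1) ≠ inv (a i))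
    (hs : ∀ φ, ¬ Splits a n φ) :
    ∃ d, d ≠ 0 ∧ d ∣ n ∧ (∀ i, a (i + d) = a i) ∧ ∀ i j, i < j → j < d → (a i).1 ≠ (a j).1 := by
  set w := path a n with hw
  let R (i j : ℕ) : Prop :=
    ∀ φ : FreeGroup α →* Multiplicative ℤ, φ w = 1 → φ (path a i) = φ (path a j)
  have Rsymm : ∀ {i j}, R i j → R j i := fun h φ hφ => (h φ hφ).symm
  have Rtrans : ∀ {i j k}, R i j → R j k → R i k := fun h h' φ hφ => (h φ hφ).trans (h' φ hφ)
  have Rn : ∀ i, R i (i + n) := by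
    intro i φ hφ
    rw [add_comm, path_add_period hp, map_mul, hφ, one_mul]
  have hedge : ∀ φ : FreeGroup α →* Multiplicative ℤ, φ w = 1 → ∀ i j, (a i).1 = (a j).1 →
      (edge φ (φ (path a i)) (a i)).2 = (edge φ (φ (path a j)) (a j)).2 := by
    intro φ hφ i j hij
    by_contra h
    exact hs φ ⟨hφ, i, j, hij, fun h' => h (congrArg Prod.snd h')⟩
  have R_of_eq : ∀ {i j}, a i = a j → R i j := by
    intro i j h φ hφ
    have := hedge φ hφ i j (by rw [h])
    rw [h] at this
    simp only [edge] at this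
    split_ifs at this
    · exact this
    · exact mul_right_cancel this
  have R_of_eq_inv : ∀ {i j}, a i = inv (a j) → R (i + 1) j := by
    intro i j h φ hφ
    have := hedge φ hφ i j (by rw [h, inv])
    rw [path_succ, map_mul]
    rw [h] at this ⊢
    rw [letter_inv, map_inv]
    cases h4 : (a j).2 <;> simp [edge, inv, h4] at this
    · rw [this, mul_inv_cancel_right]
    · rw [show (((a j).1, false) : α × Bool) = inv (a j) by simp [inv, h4], letter_inv,
        map_inv] at this
      exact this
  have Rsucc : ∀ {i j}, R i j → a i = a j → R (i + 1) (j + 1) := by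
    intro i j h h' φ hφ
    rw [path_succ, path_succ, map_mul, map_mul, h', h φ hφ]
  have Rdep : ∀ {i j}, R i j → ∀ x y,
      toAdd (expSum y w) * (toAdd (expSum x (path a i)) - toAdd (expSum x (path a j))) =
      toAdd (expSum x w) * (toAdd (expSum y (path a i)) - toAdd (expSum y (path a j))) := by
    intro i j h x y
    have := h (expSum x ^ toAdd (expSum y w) * expSum y ^ (-toAdd (expSum x w))) (by
      apply toAdd.injective
      simp
      ring)
    have := congrArg toAdd this
    simp at this
    linarith
  have Rzero : ∀ {i j}, R i j → ∀ x, expSum x w = 1 →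
      expSum x (path a i) = expSum x (path a j) := fun h x hx => h _ hx
  have hex : ∃ d, d ≠ 0 ∧ ∃ i, R i (i + d) := ⟨n, hn, 0, Rn 0⟩
  classical
  set d := Nat.find hex
  obtain ⟨hd0, i0, hi0⟩ : d ≠ 0 ∧ ∃ i, R i (i + d) := Nat.find_spec hex
  have hmin : ∀ {i j}, R i j → i < j → d ≤ j - i := by
    intro i j h hij
    refine Nat.find_min' hex ⟨by omega, i, ?_⟩
    rwa [Nat.add_sub_cancel' hij.le]
  have hdist : ∀ {i j}, i < j → j - i < d → (a i).1 ≠ (a j).1 := by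
    intro i j hij hjd h
    rcases eq_or_eq_inv h with h | h
    · have := hmin (R_of_eq h) hij
      omega
    · have h1 : i + 1 ≠ j := by
        rintro rfl
        exact hr i (by rw [h, inv_inv])
      have := hmin (R_of_eq_inv h) (by omega)
      omega
  have hstep : ∀ m, R m (m + d) → a (m + d) = a m := by
    intro m hm
    by_contra hne
    have hxv : ∀ l, m ≤ l → l < m + d → (a l).1 ≠ (a (m + d)).1 := by
      intro l h1 h2 h
      rcases eq_or_eq_inv h with h | h
      · have := hmin (R_of_eq h) h2
        obtain rfl : l = m := by omega
        exact hne h.symm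
      · by_cases h3 : l + 1 = m + d
        · rw [← h3] at h
          exact hr l (by rw [h, inv_inv])
        · have := hmin (R_of_eq_inv h) (by omega)
          omega
    have hvy : expSum (a m).1 (path a m) ≠ expSum (a m).1 (path a (m + d)) :=
      expSum_path_ne le_rfl (by omega) fun q h1 h2 h3 h4 =>
        hdist (i := m) (j := q) (by omega) (by omega) h4.symm
    have hvx : expSum (a (m + d)).1 (path a m) = expSum (a (m + d)).1 (path a (m + d)) :=
      expSum_path_eq (by omega) hxv
    have hvy' : toAdd (expSum (a m).1 (path a m)) -
        toAdd (expSum (a m).1 (path a (m + d))) ≠ 0 :=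
      fun h => hvy (toAdd.injective (sub_eq_zero.1 h))
    have hwx : expSum (a (m + d)).1 w = 1 := by
      have := Rdep hm (a (m + d)).1 (a m).1
      rw [hvx, sub_self, mul_zero, eq_comm, mul_eq_zero, or_iff_left hvy'] at this
      exact toAdd.injective this
    have hexM : ∃ M, m + d < M ∧ ∃ l, m ≤ l ∧ l < M ∧ R l M :=
      ⟨m + d + n, by omega, m + d, by omega, by omega, Rn _⟩
    set M := Nat.find hexM
    obtain ⟨hM, l, hml, hlM, hRl⟩ : m + d < M ∧ ∃ l, m ≤ l ∧ l < M ∧ R l M :=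
      Nat.find_spec hexM
    have hminM : ∀ {l' M'}, R l' M' → m ≤ l' → l' < M' → m + d < M' → M ≤ M' :=
      fun h h1 h2 h3 => Nat.find_min' hexM ⟨h3, _, h1, h2, h⟩
    have huniq : ∀ {p q}, m ≤ p → p < q → m + d < q → q < M → (a p).1 ≠ (a q).1 := by
      intro p q h1 h2 h3 h4 h
      rcases eq_or_eq_inv h with h | h
      · exact absurd (hminM (R_of_eq h) h1 h2 h3) (by omega)
      · by_cases h5 : p + 1 = q
        · rw [← h5] at h
          exact hr p (by rw [h, inv_inv])
        · exact absurd (hminM (R_of_eq_inv h) (by omega) (by omega) h3) (by omega)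
    rcases le_or_gt l (m + d) with hl | hl
    · refine expSum_path_ne hl hM ?_ (Rzero hRl _ hwx)
      intro q h1 h2 h3 h4
      rcases lt_or_gt_of_ne h3 with h5 | h5
      · exact hxv q (by omega) h5 h4
      · exact huniq (by omega) h5 h5 h2 h4.symm
    · have hu : expSum (a l).1 (path a l) ≠ expSum (a l).1 (path a M) :=
        expSum_path_ne le_rfl hlM fun q h1 h2 h3 h4 =>
          huniq hml (by omega) (by omega) h2 h4.symm
      have hvz : expSum (a l).1 (path a m) = expSum (a l).1 (path a (m + d)) :=
        expSum_path_eq (by omega) fun q h1 h2 h4 => huniq h1 (by omega) hl hlM h4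
      have := Rdep hm (a l).1 (a m).1
      rw [hvz, sub_self, mul_zero, eq_comm, mul_eq_zero, or_iff_left hvy'] at this
      exact hu (Rzero hRl _ (toAdd.injective this))
  have hall : ∀ m, i0 ≤ m → R m (m + d) := by
    intro m hm
    induction m, hm using Nat.le_induction with
    | base => exact hi0
    | succ m hm ih =>
      have := Rsucc ih (hstep m ih).symm
      rwa [add_right_comm] at this
  have hpk : ∀ k i, a (i + k * n) = a i := by
    intro k
    induction k with
    | zero => simp
    | succ k ih => intro i; rw [add_mul, one_mul, ← add_assoc, hp, ih]
  refine ⟨d, hd0, ?_, ?_, fun i j h1 h2 => hdist h1 (by omega)⟩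
  · have hq : ∀ q, R i0 (i0 + d * q) := by
      intro q
      induction q with
      | zero => exact fun φ _ => rfl
      | succ q ih =>
        have := Rtrans ih (hall (i0 + d * q) (by omega))
        rwa [add_assoc, ← Nat.mul_succ] at this
    have h1 := Rtrans (Rsymm (hq (n / d))) (Rn i0)
    have h2 := Nat.div_add_mod n d
    have h3 := Nat.mod_lt n (Nat.pos_of_ne_zero hd0)
    by_contra h4
    rw [Nat.dvd_iff_mod_eq_zero] at h4
    have := hmin h1 (by omega)
    omega
  · intro i
    have h1 : i0 ≤ i + i0 * n := by nlinarith [Nat.pos_of_ne_zero hn]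
    rw [← hpk i0 (i + d), add_right_comm, hstep _ (hall _ h1), hpk]

end OneRelator

namespace OneRelator

universe u

variable {α : Type u}

open Multiplicative

lemma closure_of_mono {T T' : Set α} (h : T ⊆ T') :
    Subgroup.closure (FreeGroup.of '' T) ≤ Subgroup.closure (FreeGroup.of '' T') :=
  Subgroup.closure_mono (Set.image_mono h)

lemma exists_retraction (p : α × Bool) (g : FreeGroup α) :
    ∃ θ : FreeGroup α →* FreeGroup α,
      (∀ h ∈ Subgroup.closure (FreeGroup.of '' {p.1}ᶜ), θ h = h) ∧ θ (letter p) = g := by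
  classical
  obtain ⟨s, b⟩ := p
  refine ⟨FreeGroup.lift fun x => if x = s then (if b then g else g⁻¹) else FreeGroup.of x,
    fun h hh => ?_, ?_⟩
  · induction hh using Subgroup.closure_induction with
    | mem x hx =>
      obtain ⟨y, hy, rfl⟩ := hx
      exact (FreeGroup.lift_apply_of ..).trans (if_neg hy)
    | one => simp
    | mul x y _ _ hx hy => rw [map_mul, hx, hy]
    | inv x _ hx => rw [map_inv, hx]
  · cases b <;> simp [letter_true, letter_false]

lemma path_eq_mul_letter_mul {a : ℕ → α × Bool} {d p : ℕ} (hp : p < d)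
    (h : ∀ i < d, i ≠ p → (a i).1 ≠ (a p).1) :
    ∃ A ∈ Subgroup.closure (FreeGroup.of '' {(a p).1}ᶜ),
      ∃ B ∈ Subgroup.closure (FreeGroup.of '' {(a p).1}ᶜ),
        path a d = A * letter (a p) * B := by
  refine ⟨path a p, path_mem fun i hi => h i (by omega) (by omega),
    path (fun i => a (p + 1 + i)) (d - (p + 1)),
    path_mem fun i hi => h _ (by omega) (by omega), ?_⟩
  rw [← path_succ, ← path_add, Nat.add_sub_cancel' hp]

lemma image_letters_lseq [DecidableEq α] {Q : Type*} [Group Q] (f : FreeGroup α →* Q)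
    (a : ℕ → α × Bool) (n : ℕ) : (letters (lseq f a) n).image Prod.fst = letters a n := by
  ext x
  simp only [Finset.mem_image, mem_letters]
  constructor
  · rintro ⟨_, ⟨i, hi, rfl⟩, rfl⟩
    exact ⟨i, hi, rfl⟩
  · rintro ⟨i, hi, rfl⟩
    exact ⟨_, ⟨i, hi, rfl⟩, rfl⟩

lemma card_letters_le (a : ℕ → α × Bool) (n : ℕ) : (letters a n).card ≤ n := by
  classical
  unfold letters
  exact Finset.card_image_le.trans (by simp)

lemma card_letters_le_lseq {Q : Type*} [Group Q] (f : FreeGroup α →* Q)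
    (a : ℕ → α × Bool) (n : ℕ) : (letters a n).card ≤ (letters (lseq f a) n).card := by
  classical
  rw [← image_letters_lseq f]
  exact Finset.card_image_le

lemma exists_lt_of_period {β : Type*} {a : ℕ → β} {n : ℕ} (hn : n ≠ 0)
    (hp : ∀ i, a (i + n) = a i) (i : ℕ) : ∃ j < n, a j = a i := by
  refine ⟨i % n, Nat.mod_lt _ (Nat.pos_of_ne_zero hn), ?_⟩
  exact (Function.Periodic.map_mod_nat (f := a) hp i)

lemma mem_letters_of_period {a : ℕ → α × Bool} {n : ℕ} (hn : n ≠ 0)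
    (hp : ∀ i, a (i + n) = a i) (i : ℕ) : (a i).1 ∈ letters a n := by
  obtain ⟨j, hj, h⟩ := exists_lt_of_period hn hp i
  exact mem_letters.2 ⟨j, hj, by rw [h]⟩

lemma card_letters_lt_lseq {φ : FreeGroup α →* Multiplicative ℤ}
    {a : ℕ → α × Bool} {n : ℕ} (hn : n ≠ 0) (hp : ∀ i, a (i + n) = a i) (h : Splits a n φ) :
    (letters a n).card < (letters (lseq φ a) n).card := by
  classical
  refine lt_of_le_of_ne (card_letters_le_lseq φ a n) fun h1 => ?_
  rw [← image_letters_lseq φ, Finset.card_image_iff] at h1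
  obtain ⟨hw, i, j, hij, hne⟩ := h
  have hp' := lseq_period φ hp hw
  exact hne (h1 (mem_letters_of_period hn hp' i) (mem_letters_of_period hn hp' j) hij)

lemma exists_band (s : α) (T : Finset (α × Multiplicative ℤ)) (h : ∃ p ∈ T, p.1 = s) :
    ∃ μ M : ℤ, μ ≤ M ∧ (s, ofAdd μ) ∈ T ∧ (s, ofAdd M) ∈ T ∧ ∀ p ∈ T, p ∈ band s μ M := by
  classical
  let I := (T.filter fun p => p.1 = s).image fun p => toAdd p.2
  have hI : I.Nonempty := by
    obtain ⟨p, hp, h⟩ := h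
    exact ⟨_, Finset.mem_image_of_mem _ (Finset.mem_filter.2 ⟨hp, h⟩)⟩
  have hmem : ∀ i ∈ I, (s, ofAdd i) ∈ T := by
    intro i hi
    obtain ⟨⟨x, q⟩, hp, rfl⟩ := Finset.mem_image.1 hi
    obtain rfl : x = s := (Finset.mem_filter.1 hp).2
    exact (Finset.mem_filter.1 hp).1
  refine ⟨I.min' hI, I.max' hI, I.min'_le_max' hI, hmem _ (I.min'_mem hI),
    hmem _ (I.max'_mem hI), fun p hp hs => ?_⟩
  have : toAdd p.2 ∈ I := Finset.mem_image_of_mem _ (Finset.mem_filter.2 ⟨hp, hs⟩)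
  exact ⟨I.min'_le _ this, I.le_max' _ this⟩

lemma exists_mem_letters_lseq {Q : Type*} [Group Q] (f : FreeGroup α →* Q) {a : ℕ → α × Bool}
    {n : ℕ} {s : α} (hs : s ∈ letters a n) : ∃ p ∈ letters (lseq f a) n, p.1 = s := by
  obtain ⟨i, hi, rfl⟩ := mem_letters.1 hs
  exact ⟨_, mem_letters.2 ⟨i, hi, rfl⟩, rfl⟩

lemma exists_position {a : ℕ → α × Bool} {n d : ℕ} (hd : d ≠ 0) (hp : ∀ i, a (i + d) = a i)
    (hdist : ∀ i j, i < j → j < d → (a i).1 ≠ (a j).1) {s : α} (hs : s ∈ letters a n) :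
    ∃ p < d, (a p).1 = s ∧ ∀ i < d, i ≠ p → (a i).1 ≠ (a p).1 := by
  obtain ⟨i, hi, rfl⟩ := mem_letters.1 hs
  obtain ⟨p, hpd, h⟩ := exists_lt_of_period hd hp i
  refine ⟨p, hpd, by rw [h], fun j hj hjp => ?_⟩
  rcases lt_or_gt_of_ne hjp with h1 | h1
  · exact hdist j p h1 hpd
  · exact (hdist p j h1 hj).symm

lemma freiheitssatz_aux (N : ℕ) : ∀ {α : Type u} {a : ℕ → α × Bool} {n : ℕ}, n ≠ 0 →
    (∀ i, a (i + n) = a i) → (∀ i, a (i + 1) ≠ inv (a i)) → n - (letters a n).card ≤ N →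
    ∀ s ∈ letters a n, ∀ v ∈ Subgroup.normalClosure {path a n},
      v ∈ Subgroup.closure (FreeGroup.of '' {s}ᶜ) → v = 1 := by
  induction N using Nat.strong_induction_on with
  | _ N ih =>
  intro α a n hn hp hr hN s hs v hv hvs
  by_cases hsplit : ∃ φ, Splits a n φ
  · obtain ⟨φ, hφ⟩ := hsplit
    have hcard := card_letters_lt_lseq hn hp hφ
    have hcard' := card_letters_le (lseq φ a) n
    have hp' := lseq_period φ hp hφ.1
    have hr' := lseq_reduced φ hr
    have IH := ih (n - (letters (lseq φ a) n).card) (by omega) hn hp' hr' le_rfl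
    obtain ⟨μ, M, hμM, hμ, hM, hband⟩ := exists_band s _ (exists_mem_letters_lseq φ hs)
    rw [← lam_path] at IH
    have h1 : lam φ v ∈ Subgroup.closure (FreeGroup.of '' {p : α × Multiplicative ℤ | p.1 ≠ s}) := by
      simpa using lam_mem_closure φ hvs 1
    have h2 := lift_mem_normalClosure φ hφ.1 s hμM
      (fun v hv hv' => IH _ hM v hv (closure_of_mono (by
        rintro p hp rfl
        have := (hp rfl).2
        simp at this) hv'))
      (fun v hv hv' => IH _ hμ v hv (closure_of_mono (by
        rintro p hp rfl
        have := (hp rfl).1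
        simp at this) hv'))
      (by
        rw [lam_path]
        exact path_mem fun i hi => hband _ (mem_letters.2 ⟨i, hi, rfl⟩))
      hv 1 (by
        rw [map_one, MulAut.one_apply]
        exact closure_of_mono (fun p hp hs => absurd hs hp) h1)
    rw [map_one, MulAut.one_apply] at h2
    have h3 := IH _ hM _ h2 (closure_of_mono (by
      rintro p hp rfl
      exact hp rfl) h1)
    rw [← collapse_lam φ v, h3, map_one]
  · push Not at hsplit
    obtain ⟨d, hd, ⟨k, rfl⟩, hpd, hdist⟩ := exists_period_of_not_splits hn hp hr hsplit
    obtain ⟨p, hpd', rfl, huniq⟩ := exists_position hd hpd hdist hs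
    obtain ⟨A, hA, B, hB, hAB⟩ := path_eq_mul_letter_mul hpd' huniq
    obtain ⟨θ, hθ, hθ'⟩ := exists_retraction (a p) (A⁻¹ * B⁻¹)
    rw [path_mul_period hpd] at hv
    have : Subgroup.normalClosure {path a d ^ k} ≤ θ.ker := by
      refine Subgroup.normalClosure_le_normal ?_
      rw [Set.singleton_subset_iff]
      show θ _ = 1
      rw [map_pow, hAB, map_mul, map_mul, hθ A hA, hθ B hB, hθ']
      simp
    rw [← hθ v hvs]
    exact this hv

/-- The Freiheitssatz. -/
theorem freiheitssatz {a : ℕ → α × Bool} {n : ℕ} (hn : n ≠ 0)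
    (hp : ∀ i, a (i + n) = a i) (hr : ∀ i, a (i + 1) ≠ inv (a i))
    {s : α} (hs : s ∈ letters a n) {v : FreeGroup α} (hv : v ∈ Subgroup.normalClosure {path a n})
    (hvs : v ∈ Subgroup.closure (FreeGroup.of '' {s}ᶜ)) : v = 1 :=
  freiheitssatz_aux _ hn hp hr le_rfl s hs v hv hvs

end OneRelator

namespace OneRelator

universe u

variable {α : Type u}

open Multiplicative

/-- Conjugacy up to inversion. -/
def ConjInv {G : Type*} [Group G] (g h : G) : Prop := IsConj g h ∨ IsConj g h⁻¹

lemma ConjInv.symm {G : Type*} [Group G] {g h : G} (H : ConjInv g h) : ConjInv h g := by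
  rcases H with H | H
  · exact Or.inl H.symm
  · right
    obtain ⟨c, hc⟩ := isConj_iff.1 H
    refine isConj_iff.2 ⟨c⁻¹, ?_⟩
    rw [← _root_.inv_inv h, ← hc]
    group

lemma ConjInv.map {G H : Type*} [Group G] [Group H] (f : G →* H) {g h : G} (hgh : ConjInv g h) :
    ConjInv (f g) (f h) := by
  rcases hgh with hgh | hgh
  · exact Or.inl (f.map_isConj hgh)
  · right
    rw [← map_inv]
    exact f.map_isConj hgh

lemma ConjInv.pow {G : Type*} [Group G] {g h : G} (H : ConjInv g h) (k : ℕ) :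
    ConjInv (g ^ k) (h ^ k) := by
  rcases H with H | H <;> obtain ⟨c, hc⟩ := isConj_iff.1 H
  · exact Or.inl (isConj_iff.2 ⟨c, by rw [← conj_pow, hc]⟩)
  · exact Or.inr (isConj_iff.2 ⟨c, by rw [← conj_pow, hc, inv_pow]⟩)

/-- Left translation of a sequence of signed edges of a Cayley graph. -/
def sseq {Q : Type*} [Group Q] (q : Q) (a : ℕ → (α × Q) × Bool) (i : ℕ) : (α × Q) × Bool :=
  (((a i).1.1, q * (a i).1.2), (a i).2)

lemma path_sseq {Q : Type*} [Group Q] (q : Q) (a : ℕ → (α × Q) × Bool) (n : ℕ) :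
    path (sseq q a) n = shift q (path a n) := by
  induction n with
  | zero => simp
  | succ n ih =>
    rw [path_succ, path_succ, map_mul, ih]
    exact congrArg _ (shift_letter q (a n).1 (a n).2).symm

lemma card_letters_sseq {Q : Type*} [Group Q] (q : Q) (a : ℕ → (α × Q) × Bool) (n : ℕ) :
    (letters a n).card ≤ (letters (sseq q a) n).card := by
  classical
  have : (letters a n).image (fun p => (p.1, q * p.2)) ⊆ letters (sseq q a) n := by
    intro x hx
    obtain ⟨y, hy, rfl⟩ := Finset.mem_image.1 hx
    obtain ⟨i, hi, rfl⟩ := mem_letters.1 hy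
    exact mem_letters.2 ⟨i, hi, rfl⟩
  refine le_trans (le_of_eq ?_) (Finset.card_le_card this)
  rw [Finset.card_image_of_injective]
  rintro ⟨x, y⟩ ⟨x', y'⟩ h
  simpa using h

/-- Periodic sequences spelling a cyclically reduced word. -/
structure CycRed (a : ℕ → α × Bool) (n : ℕ) : Prop where
  ne : n ≠ 0
  period : ∀ i, a (i + n) = a i
  reduced : ∀ i, a (i + 1) ≠ inv (a i)

lemma CycRed.lseq {a : ℕ → α × Bool} {n : ℕ} (h : CycRed a n) {Q : Type*} [Group Q]
    {f : FreeGroup α →* Q} (hf : f (path a n) = 1) : CycRed (lseq f a) n :=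
  ⟨h.ne, lseq_period f h.period hf, lseq_reduced f h.reduced⟩

lemma CycRed.sseq {Q : Type*} [Group Q] {a : ℕ → (α × Q) × Bool} {n : ℕ} (h : CycRed a n)
    (q : Q) : CycRed (sseq q a) n := by
  refine ⟨h.ne, fun i => by rw [OneRelator.sseq, OneRelator.sseq, h.period], fun i hi => ?_⟩
  refine h.reduced i (Prod.ext (Prod.ext ?_ ?_) ?_)
  · exact congrArg (fun p => p.1.1) hi
  · exact mul_left_cancel (congrArg (fun p => p.1.2) hi)
  · exact congrArg (fun p => p.2) hi

lemma CycRed.path_ne_one {a : ℕ → α × Bool} {n : ℕ} (h : CycRed a n) : path a n ≠ 1 :=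
  OneRelator.path_ne_one h.reduced h.ne

lemma CycRed.eq_one {a : ℕ → α × Bool} {n : ℕ} (h : CycRed a n)
    {s : α} (hs : s ∈ letters a n) {v : FreeGroup α} (hv : v ∈ Subgroup.normalClosure {path a n})
    {T : Set α} (hvs : v ∈ Subgroup.closure (FreeGroup.of '' T)) (hT : s ∉ T) : v = 1 := by
  have hsub : T ⊆ {s}ᶜ := by
    rintro x hx rfl
    exact hT hx
  exact freiheitssatz h.ne h.period h.reduced hs hv (closure_of_mono hsub hvs)

lemma CycRed.letters_subset {a b : ℕ → α × Bool} {n m : ℕ} (ha : CycRed a n) (hb : CycRed b m)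
    (h : path b m ∈ Subgroup.normalClosure {path a n}) : letters a n ⊆ letters b m := by
  intro s hs
  by_contra hsb
  exact hb.path_ne_one (ha.eq_one hs h (T := letters b m)
    (path_mem fun i hi => mem_letters.2 ⟨i, hi, rfl⟩) hsb)

lemma CycRed.lift_mem {a b : ℕ → α × Bool} {n m : ℕ} (ha : CycRed a n)
    (h : path b m ∈ Subgroup.normalClosure {path a n}) {φ : FreeGroup α →* Multiplicative ℤ}
    (hφ : φ (path a n) = 1) {s : α} {μ M : ℤ} (hμM : μ ≤ M)
    (hμ : (s, ofAdd μ) ∈ letters (OneRelator.lseq φ a) n)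
    (hM : (s, ofAdd M) ∈ letters (OneRelator.lseq φ a) n)
    (hband : ∀ p ∈ letters (OneRelator.lseq φ a) n, p ∈ band s μ M) {c : ℤ}
    (hband' : ∀ p ∈ letters (OneRelator.lseq φ b) m, p ∈ band s (μ - c) (M - c)) :
    shift (ofAdd c) (lam φ (path b m)) ∈ Subgroup.normalClosure {lam φ (path a n)} := by
  have ha' := ha.lseq hφ
  refine lift_mem_normalClosure φ hφ s hμM ?_ ?_ ?_ h _ ?_
  · intro v hv hv'
    rw [lam_path] at hv
    refine ha'.eq_one hM hv hv' fun h => ?_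
    have := (h rfl).2
    simp at this
  · intro v hv hv'
    rw [lam_path] at hv
    refine ha'.eq_one hμ hv hv' fun h => ?_
    have := (h rfl).1
    simp at this
  · rw [lam_path]
    exact path_mem fun i hi => hband _ (mem_letters.2 ⟨i, hi, rfl⟩)
  · rw [lam_path]
    refine shift_mem_closure (T := band s (μ - c) (M - c)) ?_
      (path_mem fun i hi => hband' _ (mem_letters.2 ⟨i, hi, rfl⟩))
    intro p hp hs
    have := hp hs
    simp only [toAdd_mul, toAdd_ofAdd]
    omega

lemma normalClosure_le_ker {G H : Type*} [Group G] [Group H] {g : G} {f : G →* H}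
    (h : f g = 1) : Subgroup.normalClosure {g} ≤ f.ker :=
  Subgroup.normalClosure_le_normal (Set.singleton_subset_iff.2 h)

lemma toAdd_expSum_letter (p : α × Bool) :
    toAdd (expSum p.1 (letter p)) = 1 ∨ toAdd (expSum p.1 (letter p)) = -1 := by
  obtain ⟨x, b⟩ := p
  cases b <;> simp [letter_true, letter_false, expSum]

lemma dvd_of_pow_mem_normalClosure {ρ σ : FreeGroup α} {k l : ℕ} {x : α}
    (h : σ ^ l ∈ Subgroup.normalClosure {ρ ^ k})
    (hσ : toAdd (expSum x σ) = 1 ∨ toAdd (expSum x σ) = -1) : k ∣ l := by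
  have h1 : Subgroup.normalClosure {ρ ^ k} ≤
      (Subgroup.zpowers (expSum x (ρ ^ k))).comap (expSum x) :=
    Subgroup.normalClosure_le_normal
      (Set.singleton_subset_iff.2 (Subgroup.mem_zpowers _))
  obtain ⟨z, hz⟩ := Subgroup.mem_zpowers_iff.1 (h1 h)
  have h2 := congrArg toAdd hz
  simp only [map_pow, toAdd_zpow, toAdd_pow, smul_eq_mul, nsmul_eq_mul] at h2
  rw [← Int.natCast_dvd_natCast]
  rcases hσ with hσ | hσ <;> rw [hσ] at h2
  · exact ⟨z * toAdd (expSum x ρ), by linarith⟩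
  · exact ⟨-(z * toAdd (expSum x ρ)), by linarith⟩

lemma expSum_of_mem_closure {x : α} {g : FreeGroup α}
    (h : g ∈ Subgroup.closure (FreeGroup.of '' {x}ᶜ)) : expSum x g = 1 := by
  have : Subgroup.closure (FreeGroup.of '' {x}ᶜ) ≤ (expSum x).ker := by
    rw [Subgroup.closure_le]
    rintro _ ⟨y, hy, rfl⟩
    exact expSum_letter_of_ne (p := (y, true)) hy
  exact this h

lemma conjInv_of_not_splits {a b : ℕ → α × Bool} {n m : ℕ} (ha : CycRed a n) (hb : CycRed b m)
    (h : Subgroup.normalClosure {path a n} = Subgroup.normalClosure {path b m})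
    (hsa : ∀ φ, ¬ Splits a n φ) (hsb : ∀ φ, ¬ Splits b m φ) :
    ConjInv (path a n) (path b m) := by
  have hmem : path b m ∈ Subgroup.normalClosure {path a n} := by
    rw [h]; exact Subgroup.subset_normalClosure rfl
  have hmem' : path a n ∈ Subgroup.normalClosure {path b m} := by
    rw [← h]; exact Subgroup.subset_normalClosure rfl
  have hsub := ha.letters_subset hb hmem
  obtain ⟨d, hd, ⟨k, rfl⟩, hpd, hdist⟩ :=
    exists_period_of_not_splits ha.ne ha.period ha.reduced hsa
  obtain ⟨e, he, ⟨l, rfl⟩, hpe, hdist'⟩ :=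
    exists_period_of_not_splits hb.ne hb.period hb.reduced hsb
  have hs := mem_letters_of_period ha.ne ha.period 0
  obtain ⟨p, hpd', hp0, huniq⟩ := exists_position hd hpd hdist hs
  obtain ⟨p', hpe', hp', huniq'⟩ := exists_position he hpe hdist' (hsub hs)
  rw [← hp0] at hp'
  obtain ⟨A, hA, B, hB, hAB⟩ := path_eq_mul_letter_mul hpd' huniq
  obtain ⟨C, hC, D, hD, hCD⟩ := path_eq_mul_letter_mul hpe' huniq'
  rw [path_mul_period hpd, path_mul_period hpe] at hmem hmem' ⊢
  have hσ1 : expSum (b p').1 (path b e) = expSum (b p').1 (letter (b p')) := by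
    rw [hCD, map_mul, map_mul, expSum_of_mem_closure hC, expSum_of_mem_closure hD]
    simp
  have hρ1 : expSum (a p).1 (path a d) = expSum (a p).1 (letter (a p)) := by
    rw [hAB, map_mul, map_mul, expSum_of_mem_closure hA, expSum_of_mem_closure hB]
    simp
  have hkl : k = l := Nat.dvd_antisymm
    (dvd_of_pow_mem_normalClosure hmem (x := (b p').1) (by
      rw [hσ1]; exact toAdd_expSum_letter _))
    (dvd_of_pow_mem_normalClosure hmem' (x := (a p).1) (by
      rw [hρ1]; exact toAdd_expSum_letter _))
  subst hkl
  have hk : k ≠ 0 := right_ne_zero_of_mul ha.ne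
  refine ConjInv.pow ?_ k
  rw [hp'] at hC hD
  obtain ⟨θ, hθ, hθ'⟩ := exists_retraction (a p) (A⁻¹ * B⁻¹)
  have hker : Subgroup.normalClosure {path a d ^ k} ≤ θ.ker := by
    refine normalClosure_le_ker ?_
    rw [map_pow, hAB, map_mul, map_mul, hθ A hA, hθ B hB, hθ']
    simp
  have h1 : θ (path b e) = 1 := by
    have : θ (path b e) ^ k = 1 := by
      rw [← map_pow]
      exact hker hmem
    exact (pow_eq_one_iff_left hk).1 this
  rw [hCD, map_mul, map_mul, hθ C hC, hθ D hD] at h1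
  rw [hAB, hCD]
  rcases eq_or_eq_inv hp' with h2 | h2
  · rw [h2, hθ'] at h1
    rw [h2]
    left
    have h3 : D * C = B * A := by
      rw [eq_comm, ← inv_inj, ← mul_left_inj (a := D), ← mul_right_inj (a := C)]
      simpa [mul_assoc] using h1
    refine isConj_iff.2 ⟨C * A⁻¹, ?_⟩
    calc _ = C * letter (a p) * (B * A) * C⁻¹ := by group
      _ = _ := by rw [← h3]; group
  · rw [h2, letter_inv, map_inv, hθ'] at h1
    rw [h2, letter_inv]
    right
    have h3 : B * A = C⁻¹ * D⁻¹ := by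
      rw [← mul_right_inj C, ← mul_left_inj D]
      simpa [mul_assoc] using h1
    refine isConj_iff.2 ⟨D⁻¹ * A⁻¹, ?_⟩
    calc _ = D⁻¹ * letter (a p) * (B * A) * D := by group
      _ = _ := by rw [h3]; group

lemma conjInv_aux (N : ℕ) : ∀ {α : Type u} {a b : ℕ → α × Bool} {n m : ℕ},
    CycRed a n → CycRed b m →
    (n - (letters a n).card) + (m - (letters b m).card) ≤ N →
    Subgroup.normalClosure {path a n} = Subgroup.normalClosure {path b m} →
    ConjInv (path a n) (path b m) := by
  induction N using Nat.strong_induction_on with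
  | _ N ih =>
  intro α a b n m ha hb hN h
  have hmem : path b m ∈ Subgroup.normalClosure {path a n} := by
    rw [h]; exact Subgroup.subset_normalClosure rfl
  have hmem' : path a n ∈ Subgroup.normalClosure {path b m} := by
    rw [← h]; exact Subgroup.subset_normalClosure rfl
  by_cases hsplit : ∃ φ, Splits a n φ ∨ Splits b m φ
  · obtain ⟨φ, hφ⟩ := hsplit
    have hφa : φ (path a n) = 1 :=
      hφ.elim (fun h => h.1) fun h' => normalClosure_le_ker h'.1 hmem'
    have hφb : φ (path b m) = 1 := normalClosure_le_ker hφa hmem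
    have ha' := ha.lseq hφa
    have hb' := hb.lseq hφb
    have hlt : (n - (letters (lseq φ a) n).card) + (m - (letters (lseq φ b) m).card) < N := by
      have h1 := card_letters_le_lseq φ a n
      have h2 := card_letters_le_lseq φ b m
      have h3 := card_letters_le (lseq φ a) n
      have h4 := card_letters_le (lseq φ b) m
      rcases hφ with hφ | hφ
      · have := card_letters_lt_lseq ha.ne ha.period hφ
        omega
      · have := card_letters_lt_lseq hb.ne hb.period hφ
        omega
    have hs := mem_letters_of_period ha.ne ha.period 0
    set s := (a 0).1
    obtain ⟨μ, M, hμM, hμ, hM, hband⟩ := exists_band s _ (exists_mem_letters_lseq φ hs)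
    obtain ⟨μ', M', hμM', hμ', hM', hband'⟩ :=
      exists_band s _ (exists_mem_letters_lseq φ (ha.letters_subset hb hmem hs))
    have hmem1 : M' - μ' ≤ M - μ → shift (ofAdd (μ - μ')) (lam φ (path b m)) ∈
        Subgroup.normalClosure {lam φ (path a n)} := fun hle =>
      ha.lift_mem hmem hφa hμM hμ hM hband fun p hp hs => by
        have := hband' p hp hs
        omega
    have hmem2 : M - μ ≤ M' - μ' → shift (ofAdd (μ' - μ)) (lam φ (path a n)) ∈
        Subgroup.normalClosure {lam φ (path b m)} := fun hle =>
      hb.lift_mem hmem' hφb hμM' hμ' hM' hband' fun p hp hs => by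
        have := hband p hp hs
        omega
    have hcontra : ∀ {a b : ℕ → α × Bool} {n m : ℕ} {μ M μ' M' : ℤ}, CycRed b m →
        CycRed (lseq φ a) n → (s, ofAdd M) ∈ letters (lseq φ a) n →
        (∀ p ∈ letters (lseq φ b) m, p ∈ band s μ' M') →
        shift (ofAdd (μ - μ')) (lam φ (path b m)) ∈ Subgroup.normalClosure {lam φ (path a n)} →
        M - μ ≤ M' - μ' := by
      intro a b n m μ M μ' M' hb ha' hM hband' hmem
      by_contra! hlt
      rw [lam_path φ a] at hmem
      have := ha'.eq_one hM hmem (T := band s μ (M - 1)) (by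
        rw [lam_path]
        refine shift_mem_closure (T := band s μ' M') ?_
          (path_mem fun i hi => hband' _ (mem_letters.2 ⟨i, hi, rfl⟩))
        intro p hp hs
        have := hp hs
        simp only [toAdd_mul, toAdd_ofAdd]
        omega) (fun h => by
          have := (h rfl).2
          simp at this)
      rw [map_eq_one_iff _ (MulEquiv.injective _)] at this
      exact hb.path_ne_one (by rw [← collapse_lam φ (path b m), this, map_one])
    have heq : M' - μ' = M - μ := by
      rcases le_total (M' - μ') (M - μ) with hle | hle
      · exact le_antisymm hle (hcontra hb ha' hM hband' (hmem1 hle))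
      · exact le_antisymm (hcontra ha hb' hM' hband (hmem2 hle)) hle
    have h1 := hmem1 heq.le
    have h2 := shift_mem_normalClosure (ofAdd (μ - μ')) (hmem2 heq.ge)
    rw [← MulAut.mul_apply, ← map_mul, ← ofAdd_add, sub_add_sub_cancel, sub_self, ofAdd_zero,
      map_one, MulAut.one_apply] at h2
    have h3 := ih _ hlt ha' (hb'.sseq (ofAdd (μ - μ')))
      (by have := card_letters_sseq (ofAdd (μ - μ')) (lseq φ b) m; omega) (by
        rw [path_sseq, ← lam_path, ← lam_path]
        refine le_antisymm ?_ ?_ <;>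
          refine Subgroup.normalClosure_le_normal (Set.singleton_subset_iff.2 ?_)
        · exact h2
        · exact h1)
    have h4 := h3.map collapse
    rwa [path_sseq, collapse_shift, ← lam_path, ← lam_path, collapse_lam, collapse_lam] at h4
  · push Not at hsplit
    exact conjInv_of_not_splits ha hb h (fun φ => (hsplit φ).1) fun φ => (hsplit φ).2

lemma exists_seq_of_list {L : List (α × Bool)} (h : L ≠ []) :
    ∃ a : ℕ → α × Bool, (∀ i, a (i + L.length) = a i) ∧ path a L.length = FreeGroup.mk L ∧
      ∀ i (hi : i < L.length), a i = L[i] := by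
  have hL : 0 < L.length := List.length_pos_of_ne_nil h
  refine ⟨fun i => L[i % L.length]'(Nat.mod_lt _ hL), fun i => by simp, ?_, fun i hi => by
    simp [Nat.mod_eq_of_lt hi]⟩
  rw [path_eq_mk]
  congr 1
  refine List.ext_getElem (by simp) fun i h1 h2 => ?_
  simp [Nat.mod_eq_of_lt h2]

lemma exists_cycRed {w : FreeGroup α} (hw : w ≠ 1) :
    ∃ a n, CycRed a n ∧ IsConj w (path a n) := by
  classical
  have hL := FreeGroup.reduceCyclically.isCyclicallyReduced (FreeGroup.isReduced_toWord (x := w))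
  have hc := congrArg FreeGroup.mk
    (FreeGroup.reduceCyclically.conj_conjugator_reduceCyclically w.toWord)
  rw [← FreeGroup.mul_mk, ← FreeGroup.mul_mk, ← FreeGroup.inv_mk, FreeGroup.mk_toWord] at hc
  generalize FreeGroup.reduceCyclically w.toWord = L at hL hc
  have hne : L ≠ [] := by
    rintro rfl
    exact hw (by rw [← hc, ← FreeGroup.one_eq_mk]; group)
  obtain ⟨a, ha, ha', hget⟩ := exists_seq_of_list hne
  have hpos : 0 < L.length := List.length_pos_of_ne_nil hne
  refine ⟨a, L.length, ⟨hpos.ne', ha, fun i hi => ?_⟩, ?_⟩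
  · have hmod : a i = a (i % L.length) := (Function.Periodic.map_mod_nat (f := a) ha i).symm
    have hmod' : a (i + 1) = a ((i % L.length) + 1) := by
      rw [← Function.Periodic.map_mod_nat (f := a) ha (i + 1),
        ← Function.Periodic.map_mod_nat (f := a) ha (i % L.length + 1), Nat.mod_add_mod]
    have hlt := Nat.mod_lt i hpos
    rw [hmod, hmod'] at hi
    generalize i % L.length = j at hi hlt
    have h1 : (a j).1 = (a (j + 1)).1 → (a j).2 = (a (j + 1)).2 := by
      by_cases hj : j + 1 < L.length
      · rw [hget j hlt, hget (j + 1) hj]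
        exact List.isChain_iff_getElem.1 hL.1 j hj
      · have h0 : a (j + 1) = a 0 := by
          rw [← ha 0]
          congr 1
          omega
        rw [h0, hget 0 hpos, hget j hlt]
        refine hL.2 _ ?_ _ ?_
        · have h2 : j = L.length - 1 := by omega
          subst h2
          rw [List.getLast?_eq_getElem?, Option.mem_def, List.getElem?_eq_some_iff]
          exact ⟨by omega, rfl⟩
        · rw [List.head?_eq_getElem?, Option.mem_def, List.getElem?_eq_some_iff]
          exact ⟨hpos, rfl⟩
    rw [hi] at h1
    simp [inv] at h1
  · rw [ha', isConj_comm]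
    exact isConj_iff.2 ⟨_, hc⟩

lemma normalClosure_eq_of_isConj {G : Type*} [Group G] {g h : G} (H : IsConj g h) :
    Subgroup.normalClosure {g} = Subgroup.normalClosure {h} := by
  have key : ∀ {g h : G}, IsConj g h →
      Subgroup.normalClosure {h} ≤ Subgroup.normalClosure {g} := by
    intro g h H
    obtain ⟨c, rfl⟩ := isConj_iff.1 H
    refine Subgroup.normalClosure_le_normal ?_
    rw [Set.singleton_subset_iff]
    exact Subgroup.normalClosure_normal.conj_mem g (Subgroup.subset_normalClosure (Set.mem_singleton g)) c
  exact le_antisymm (key H.symm) (key H)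

/-- Two elements of a free group with the same normal closure are conjugate up to inversion. -/
theorem isConj_of_normalClosure_eq {w r : FreeGroup α}
    (h : Subgroup.normalClosure {w} = Subgroup.normalClosure {r}) :
    IsConj w r ∨ IsConj w r⁻¹ := by
  have hone : ∀ g : FreeGroup α, Subgroup.normalClosure {g} = ⊥ ↔ g = 1 := by
    intro g
    rw [Subgroup.normalClosure_eq_bot_iff, Set.singleton_subset_iff, Set.mem_singleton_iff]
  by_cases hw : w = 1
  · have hr : r = 1 := by rw [← hone, ← h, hone, hw]
    rw [hw, hr]
    exact Or.inl (IsConj.refl _)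
  have hr : r ≠ 1 := by rwa [Ne, ← hone, ← h, hone]
  obtain ⟨a, n, ha, hwa⟩ := exists_cycRed hw
  obtain ⟨b, m, hb, hrb⟩ := exists_cycRed hr
  have h1 : ConjInv (path a n) (path b m) := by
    refine conjInv_aux _ ha hb le_rfl ?_
    rw [← normalClosure_eq_of_isConj hwa, ← normalClosure_eq_of_isConj hrb, h]
  rcases h1 with h1 | h1
  · exact Or.inl (hwa.trans (h1.trans hrb.symm))
  · refine Or.inr (hwa.trans (h1.trans ?_))
    obtain ⟨c, hc⟩ := isConj_iff.1 hrb.symm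
    exact isConj_iff.2 ⟨c, by rw [← conj_inv, hc]⟩

end OneRelator

namespace OneRelator

open Multiplicative

/-- Every nontrivial finitely generated subgroup maps onto `ℤ`. -/
def LocInd (Q : Type*) [Group Q] : Prop :=
  ∀ H : Subgroup Q, H.FG → H ≠ ⊥ → ∃ φ : H →* Multiplicative ℤ, φ ≠ 1

lemma exists_hom_of_torsionFree (A : Type*) [CommGroup A] [Group.FG A] [Nontrivial A]
    (h : ∀ x : A, ∀ k : ℕ, k ≠ 0 → x ^ k = 1 → x = 1) : ∃ φ : A →* Multiplicative ℤ, φ ≠ 1 := by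
  have : Module.Finite ℤ (Additive A) :=
    Module.Finite.iff_addGroup_fg.2 (GroupFG.iff_add_fg.1 inferInstance)
  have : IsAddTorsionFree (Additive A) := by
    refine ⟨fun n hn x y hxy => ?_⟩
    have h0 : x.toMul ^ n = y.toMul ^ n := hxy
    have h1 : (x.toMul / y.toMul) ^ n = 1 := by
      rw [div_pow, h0, div_self']
    have h2 : x.toMul = y.toMul := div_eq_one.1 (h _ n hn h1)
    exact h2
  have : Module.IsTorsionFree ℤ (Additive A) := inferInstance
  have : Module.Free ℤ (Additive A) := Module.free_of_finite_type_torsion_free'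
  obtain ⟨x, hx⟩ := exists_ne (0 : Additive A)
  let b := Module.Free.chooseBasis ℤ (Additive A)
  have : b.repr x ≠ 0 := by simpa using hx
  obtain ⟨i, hi⟩ := Finsupp.ne_iff.1 this
  refine ⟨AddMonoidHom.toMultiplicativeRight (b.coord i).toAddMonoidHom, fun h0 => hi ?_⟩
  exact congrArg toAdd (DFunLike.congr_fun h0 x.toMul)

lemma LocInd.of_hom {Q Q' : Type*} [Group Q] [Group Q'] (hQ : LocInd Q) (π : Q' →* Q)
    (hcomm : ∀ x ∈ π.ker, ∀ y ∈ π.ker, x * y = y * x)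
    (htf : ∀ x ∈ π.ker, ∀ k : ℕ, k ≠ 0 → x ^ k = 1 → x = 1) : LocInd Q' := by
  intro H hH hne
  by_cases hbot : H.map π = ⊥
  · have hle : H ≤ π.ker := (Subgroup.map_eq_bot_iff _).1 hbot
    let _ : CommGroup H :=
      { (inferInstance : Group H) with
        mul_comm := fun x y => Subtype.ext (hcomm _ (hle x.2) _ (hle y.2)) }
    have : Group.FG H := (Group.fg_iff_subgroup_fg H).2 hH
    have : Nontrivial H := (Subgroup.nontrivial_iff_ne_bot H).2 hne
    exact exists_hom_of_torsionFree H fun x k hk hx =>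
      Subtype.ext (htf _ (hle x.2) k hk (congrArg Subtype.val hx))
  · obtain ⟨φ, hφ⟩ := hQ (H.map π) ((Subgroup.fg_iff_submonoid_fg _).2
      (((Subgroup.fg_iff_submonoid_fg H).1 hH).map π)) hbot
    refine ⟨φ.comp (π.subgroupMap H), fun h => hφ ?_⟩
    ext ⟨x, hx⟩
    obtain ⟨y, hy, rfl⟩ := hx
    exact congrArg toAdd (DFunLike.congr_fun h ⟨y, hy⟩)

lemma exists_level {Q : Type*} [Group Q] {H : Subgroup Q} (φ : H →* Multiplicative ℤ) :
    ∃ l : Q → ℤ, ∀ q, ∀ h : H, l (q * h) = l q + toAdd (φ h) := by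
  have hmem : ∀ q : Q, (Quotient.out (q : Q ⧸ H))⁻¹ * q ∈ H := fun q =>
    QuotientGroup.eq.1 (Quotient.out_eq (q : Q ⧸ H))
  refine ⟨fun q => toAdd (φ ⟨_, hmem q⟩), fun q h => ?_⟩
  rw [← toAdd_mul, ← map_mul]
  refine congrArg (fun x => toAdd (φ x)) (Subtype.ext ?_)
  show (Quotient.out ((q * h : Q) : Q ⧸ H))⁻¹ * (q * h) = (Quotient.out (q : Q ⧸ H))⁻¹ * q * h
  rw [QuotientGroup.mk_mul_of_mem q h.2, mul_assoc]

lemma LocInd.exists_levels {Q : Type*} [Group Q] (hQ : LocInd Q) {A : Finset Q} {a : Q}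
    (ha : a ∈ A) (ha1 : a ≠ 1) : ∃ φ : Q → ℤ, ∃ l : Q → ℤ, ∃ r : Q → ℤ,
      (∀ a ∈ A, ∀ q, l (a * q) = φ a + l q) ∧ (∀ a ∈ A, ∀ q, r (q * a) = r q + φ a) ∧
      φ 1 = 0 ∧ ∃ a ∈ A, φ a ≠ 0 := by
  let H := Subgroup.closure (A : Set Q)
  have hsub : ∀ a ∈ A, a ∈ H := fun a ha => Subgroup.subset_closure ha
  obtain ⟨ψ, hψ⟩ := hQ H ⟨A, rfl⟩ (by
    intro h
    have := hsub a ha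
    rw [h] at this
    exact ha1 this)
  obtain ⟨r, hr⟩ := exists_level ψ
  classical
  let φ : Q → ℤ := fun q => if h : q ∈ H then toAdd (ψ ⟨q, h⟩) else 0
  have hφ : ∀ h : H, φ h = toAdd (ψ h) := fun h => dif_pos h.2
  refine ⟨φ, fun q => - r q⁻¹, r, fun a ha q => ?_, fun a ha q => ?_, ?_, ?_⟩
  · have h1 := hr q⁻¹ (⟨a, hsub a ha⟩⁻¹)
    have h2 := hφ ⟨a, hsub a ha⟩
    simp only [map_inv, toAdd_inv] at h1
    show -r (a * q)⁻¹ = φ a + -r q⁻¹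
    have h3 : (a * q)⁻¹ = q⁻¹ * ((⟨a, hsub a ha⟩⁻¹ : H) : Q) := by simp
    rw [h3, h1]
    simp only at h2
    rw [h2]
    ring
  · have h2 := hφ ⟨a, hsub a ha⟩
    simp only at h2
    rw [h2]
    exact hr q ⟨a, hsub a ha⟩
  · have := hφ 1
    simpa using this
  · by_contra! h
    refine hψ (MonoidHom.eq_of_eqOn_dense (s := (Subtype.val ⁻¹' (A : Set Q) : Set H)) ?_ ?_)
    · exact Subgroup.closure_closure_coe_preimage
    · intro x hx
      have := h x hx
      rw [hφ] at this
      exact toAdd.injective this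

lemma exists_top {β : Type*} [DecidableEq β] (A : Finset β) (hA : A.Nonempty) (φ : β → ℤ) :
    ∃ p, (∀ a ∈ A, φ a ≤ p) ∧ (A.filter fun a => φ a = p).Nonempty := by
  obtain ⟨a, ha, h⟩ := A.exists_max_image φ hA
  exact ⟨φ a, h, a, Finset.mem_filter.2 ⟨ha, rfl⟩⟩

lemma UniqueMul.of_levels {Q : Type*} [Group Q] [DecidableEq Q] {A B : Finset Q} {φ l : Q → ℤ}
    (hl : ∀ a ∈ A, ∀ q, l (a * q) = φ a + l q) {p m : ℤ} (hp : ∀ a ∈ A, φ a ≤ p)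
    (hm : ∀ b ∈ B, l b ≤ m) {a0 b0 : Q} (ha0 : a0 ∈ A.filter fun a => φ a = p)
    (hb0 : b0 ∈ B.filter fun b => l b = m)
    (h : UniqueMul (A.filter fun a => φ a = p) (B.filter fun b => l b = m) a0 b0) :
    UniqueMul A B a0 b0 := by
  intro a b ha hb hab
  rw [Finset.mem_filter] at ha0 hb0
  have h1 := hl a ha b
  have h2 := hl a0 ha0.1 b0
  have h3 := hp a ha
  have h4 := hm b hb
  have h5 := ha0.2
  have h6 := hb0.2
  rw [hab] at h1
  exact h (Finset.mem_filter.2 ⟨ha, by omega⟩) (Finset.mem_filter.2 ⟨hb, by omega⟩) hab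

lemma LocInd.uniqueProds {Q : Type*} [Group Q] (hQ : LocInd Q) (N : ℕ) :
    ∀ A B : Finset Q, A.Nonempty → B.Nonempty → A.card ≤ N →
      ∃ a ∈ A, ∃ b ∈ B, UniqueMul A B a b := by
  classical
  induction N with
  | zero =>
    intro A B hA hB h
    exact absurd (Finset.card_pos.2 hA) (by omega)
  | succ N ih =>
    have key : ∀ A B : Finset Q, 1 ∈ A → B.Nonempty → A.card ≤ N + 1 →
        ∃ a ∈ A, ∃ b ∈ B, UniqueMul A B a b := by
      intro A B h1 hB hc
      by_cases hA : ∃ a ∈ A, a ≠ 1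
      · obtain ⟨a, ha, ha1⟩ := hA
        obtain ⟨φ, l, -, hl, -, hφ1, a', ha', hφa'⟩ := hQ.exists_levels ha ha1
        obtain ⟨p, hp, hpne⟩ := exists_top A ⟨1, h1⟩ φ
        obtain ⟨m, hm, hmne⟩ := exists_top B hB l
        have hlt : (A.filter fun a => φ a = p).card < A.card := by
          refine Finset.card_lt_card (Finset.filter_ssubset.2 ?_)
          by_contra! hcon
          exact hφa' (by rw [hcon _ ha', ← hcon _ h1, hφ1])
        obtain ⟨a0, ha0, b0, hb0, h⟩ := ih _ _ hpne hmne (by omega)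
        exact ⟨a0, (Finset.mem_filter.1 ha0).1, b0, (Finset.mem_filter.1 hb0).1,
          UniqueMul.of_levels hl hp hm ha0 hb0 h⟩
      · push Not at hA
        obtain ⟨b, hb⟩ := hB
        refine ⟨1, h1, b, hb, fun a' b' ha' hb' h => ?_⟩
        rw [hA a' ha'] at h ⊢
        simpa using h
    intro A B ⟨a0, ha0⟩ hB hc
    obtain ⟨a, ha, b, hb, h⟩ := key (A.image fun a => a0⁻¹ * a) B
      (Finset.mem_image.2 ⟨a0, ha0, by simp⟩) hB (Finset.card_image_le.trans hc)
    obtain ⟨a, ha', rfl⟩ := Finset.mem_image.1 ha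
    refine ⟨a, ha', b, hb, fun a' b' h1 h2 h3 => ?_⟩
    have := h (Finset.mem_image_of_mem _ h1) h2 (by rw [mul_assoc, mul_assoc, h3])
    exact ⟨mul_left_cancel this.1, this.2⟩

/-- Left translation of finitely supported functions on the edges of a Cayley graph. -/
noncomputable def tr {α Q : Type*} [Group Q] (q : Q) : (α × Q →₀ ℤ) ≃+ (α × Q →₀ ℤ) :=
  Finsupp.domCongr (Equiv.prodCongr (Equiv.refl α) (Equiv.mulLeft q))

lemma tr_apply {α Q : Type*} [Group Q] (q : Q) (x : α × Q →₀ ℤ) (p : α × Q) :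
    tr q x p = x (p.1, q⁻¹ * p.2) := by
  simp [tr, Prod.map]

/-- Over a locally indicable group, a multiple of `x` supported in the support of `x` is an integer
multiple of `x`. -/
theorem LocInd.eq_smul_of_support_subset {α Q : Type*} [Group Q] (hQ : LocInd Q)
    {x y : α × Q →₀ ℤ} (hy : y ∈ Submodule.span ℤ (Set.range fun q => tr q x))
    (hs : ∀ e, x e = 0 → y e = 0) : ∃ n : ℤ, y = n • x := by
  classical
  obtain ⟨u, rfl⟩ := (Finsupp.mem_span_range_iff_exists_finsupp).1 hy
  by_cases hu : ∀ a ∈ u.support, a = 1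
  · refine ⟨u 1, ?_⟩
    rw [Finsupp.sum, Finset.sum_subset (s₂ := {1}) (fun a ha => by simpa using hu a ha)
      (fun a _ ha => by rw [Finsupp.notMem_support_iff.1 ha, zero_smul]), Finset.sum_singleton]
    congr 1
    ext p
    simp [tr_apply]
  push Not at hu
  obtain ⟨a, ha, ha1⟩ := hu
  by_cases hx : x = 0
  · exact ⟨0, by simp [hx]⟩
  obtain ⟨⟨s, q0⟩, hsq⟩ := Finsupp.ne_iff.1 hx
  exfalso
  let X : Finset Q := (x.support.filter fun p => p.1 = s).image Prod.snd
  have hX : ∀ q, q ∈ X ↔ x (s, q) ≠ 0 := by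
    intro q
    simp [X]
  obtain ⟨φ, l, hl, p, hp, hppos, hpne⟩ : ∃ φ : Q → ℤ, ∃ l : Q → ℤ,
      (∀ a ∈ u.support, ∀ q, l (a * q) = φ a + l q) ∧ ∃ p, (∀ a ∈ u.support, φ a ≤ p) ∧ 0 < p ∧
      (u.support.filter fun a => φ a = p).Nonempty := by
    obtain ⟨φ, l, -, hl, -, -, a', ha', hφa'⟩ := hQ.exists_levels ha ha1
    rcases lt_or_gt_of_ne hφa' with h | h
    · obtain ⟨p, hp, hpne⟩ := exists_top u.support ⟨a, ha⟩ (-φ)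
      refine ⟨-φ, -l, fun a ha q => ?_, p, hp, ?_, hpne⟩
      · have := hl a ha q
        simp only [Pi.neg_apply]
        omega
      · have := hp a' ha'
        simp only [Pi.neg_apply] at this
        omega
    · obtain ⟨p, hp, hpne⟩ := exists_top u.support ⟨a, ha⟩ φ
      exact ⟨φ, l, hl, p, hp, by have := hp a' ha'; omega, hpne⟩
  obtain ⟨m, hm, hmne⟩ := exists_top X ⟨q0, (hX q0).2 hsq⟩ l
  obtain ⟨a0, ha0, b0, hb0, h⟩ := hQ.uniqueProds _ _ _ hpne hmne le_rfl
  have hu := UniqueMul.of_levels hl hp hm ha0 hb0 h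
  rw [Finset.mem_filter] at ha0 hb0
  have hval : (u.sum fun q n => n • tr q x) (s, a0 * b0) = u a0 * x (s, b0) := by
    rw [Finsupp.sum, Finsupp.finsetSum_apply, Finset.sum_eq_single a0]
    · simp [tr_apply]
    · intro b hb hba
      rw [Finsupp.smul_apply, tr_apply, smul_eq_mul]
      by_contra hne
      have h1 := right_ne_zero_of_mul hne
      exact hba (hu hb ((hX _).2 h1) (by simp)).1
    · intro h0
      exact absurd ha0.1 h0
  have hne : x (s, a0 * b0) ≠ 0 := by
    intro h0
    have := hs _ h0
    rw [hval] at this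
    rcases mul_eq_zero.1 this with h1 | h1
    · exact Finsupp.mem_support_iff.1 ha0.1 h1
    · exact (hX _).1 hb0.1 h1
  have h1 := hm _ ((hX _).2 hne)
  have h2 := hl _ ha0.1 b0
  have h3 := ha0.2
  have h4 := hb0.2
  omega

/-- Over a locally indicable group one can choose an element of every translate of a finite set so
that the resulting dependency relation is well-founded. -/
theorem LocInd.exists_choice {Q : Type*} [Group Q] (hQ : LocInd Q) (N : ℕ) :
    ∀ A : Finset Q, A.Nonempty → A.card ≤ N → ∃ c : Q → Q, (∀ q, c q ∈ A) ∧
      WellFounded fun q' q => q' ≠ q ∧ ∃ a ∈ A, q' * c q' = q * a := by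
  classical
  induction N with
  | zero =>
    intro A hA h
    exact absurd (Finset.card_pos.2 hA) (by omega)
  | succ N ih =>
    have key : ∀ A : Finset Q, 1 ∈ A → A.card ≤ N + 1 → ∃ c : Q → Q, (∀ q, c q ∈ A) ∧
        WellFounded fun q' q => q' ≠ q ∧ ∃ a ∈ A, q' * c q' = q * a := by
      intro A h1 hc
      by_cases hA : ∃ a ∈ A, a ≠ 1
      · obtain ⟨a, ha, ha1⟩ := hA
        obtain ⟨φ, -, r, -, hr, hφ1, a', ha', hφa'⟩ := hQ.exists_levels ha ha1
        obtain ⟨p, hp, hpne⟩ := exists_top A ⟨1, h1⟩ φ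
        obtain ⟨m, hm, hmne⟩ := exists_top A ⟨1, h1⟩ (-φ)
        have hlt : (A.filter fun a => φ a = p).card < A.card := by
          refine Finset.card_lt_card (Finset.filter_ssubset.2 ?_)
          by_contra! hcon
          exact hφa' (by rw [hcon _ ha', ← hcon _ h1, hφ1])
        have hlt' : (A.filter fun a => (-φ) a = m).card < A.card := by
          refine Finset.card_lt_card (Finset.filter_ssubset.2 ?_)
          by_contra! hcon
          have h2 := hcon _ ha'
          have h3 := hcon _ h1
          simp only [Pi.neg_apply] at h2 h3
          omega
        obtain ⟨c, hcA, hcw⟩ := ih _ hpne (by omega)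
        obtain ⟨c', hcA', hcw'⟩ := ih _ hmne (by omega)
        refine ⟨fun q => if 0 ≤ r q then c q else c' q, fun q => ?_, ?_⟩
        · dsimp only
          split_ifs
          · exact (Finset.mem_filter.1 (hcA q)).1
          · exact (Finset.mem_filter.1 (hcA' q)).1
        · have hacc : ∀ n : ℕ, ∀ q, (r q).natAbs = n → Acc (fun q' q => q' ≠ q ∧
              ∃ a ∈ A, q' * (if 0 ≤ r q' then c q' else c' q') = q * a) q := by
            intro n
            induction n using Nat.strong_induction_on with
            | _ n ihn =>
            have hpos : ∀ q, (r q).natAbs = n → 0 ≤ r q → Acc (fun q' q => q' ≠ q ∧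
                ∃ a ∈ A, q' * (if 0 ≤ r q' then c q' else c' q') = q * a) q := by
              intro q
              induction q using hcw.induction with
              | _ q ihq =>
              intro hqn hq
              refine Acc.intro _ fun q' ⟨hne, b, hb, hqb⟩ => ?_
              have h2 := hr b hb q
              rw [← hqb] at h2
              have h3 := hp b hb
              have h4 := hm b hb
              simp only [Pi.neg_apply] at h4
              split_ifs at hqb h2 with hq'
              · have h5 := Finset.mem_filter.1 (hcA q')
                have h6 := hr _ h5.1 q'
                by_cases hb' : φ b = p
                · exact ihq q' ⟨hne, b, Finset.mem_filter.2 ⟨hb, hb'⟩, hqb⟩ (by omega) hq'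
                · exact ihn (r q').natAbs (by omega) q' rfl
              · have h5 := Finset.mem_filter.1 (hcA' q')
                have h6 := hr _ h5.1 q'
                have h7 := h5.2
                simp only [Pi.neg_apply] at h7
                omega
            have hneg : ∀ q, (r q).natAbs = n → ¬ 0 ≤ r q → Acc (fun q' q => q' ≠ q ∧
                ∃ a ∈ A, q' * (if 0 ≤ r q' then c q' else c' q') = q * a) q := by
              intro q
              induction q using hcw'.induction with
              | _ q ihq =>
              intro hqn hq
              refine Acc.intro _ fun q' ⟨hne, b, hb, hqb⟩ => ?_
              have h2 := hr b hb q
              rw [← hqb] at h2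
              have h3 := hp b hb
              have h4 := hm b hb
              simp only [Pi.neg_apply] at h4
              split_ifs at hqb h2 with hq'
              · have h5 := Finset.mem_filter.1 (hcA q')
                have h6 := hr _ h5.1 q'
                omega
              · have h5 := Finset.mem_filter.1 (hcA' q')
                have h6 := hr _ h5.1 q'
                have h7 := h5.2
                simp only [Pi.neg_apply] at h7
                by_cases hb' : (-φ) b = m
                · exact ihq q' ⟨hne, b, Finset.mem_filter.2 ⟨hb, hb'⟩, hqb⟩ (by
                    simp only [Pi.neg_apply] at hb'; omega) hq'
                · simp only [Pi.neg_apply] at hb'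
                  exact ihn (r q').natAbs (by omega) q' rfl
            intro q hq
            by_cases h : 0 ≤ r q
            · exact hpos q hq h
            · exact hneg q hq h
          exact ⟨fun q => hacc _ q rfl⟩
      · push Not at hA
        refine ⟨fun _ => 1, fun _ => h1, ⟨fun q => Acc.intro _ ?_⟩⟩
        rintro q' ⟨hne, a, ha, h⟩
        rw [hA a ha] at h
        exact absurd (mul_right_cancel h) hne
    intro A ⟨a0, ha0⟩ hc
    obtain ⟨c, hc1, hc2⟩ := key (A.image fun a => a * a0⁻¹)
      (Finset.mem_image.2 ⟨a0, ha0, by simp⟩) (Finset.card_image_le.trans hc)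
    refine ⟨fun q => c q * a0, fun q => ?_, Subrelation.wf ?_ hc2⟩
    · obtain ⟨a, ha, h⟩ := Finset.mem_image.1 (hc1 q)
      simpa [← h] using ha
    · rintro q' q ⟨hne, a, ha, h⟩
      refine ⟨hne, _, Finset.mem_image_of_mem _ ha, ?_⟩
      rw [← mul_assoc, ← h]
      group

end OneRelator

namespace OneRelator

open Multiplicative

universe u

variable {α : Type u} {Q : Type*} [Group Q]

/-- The sign of a letter. -/
def sgn (b : Bool) : ℤ := if b then 1 else -1

/-- The abelianization of a free group, with values in finitely supported functions. -/
noncomputable def ab {E : Type*} : FreeGroup E →* Multiplicative (E →₀ ℤ) :=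
  FreeGroup.lift fun e => ofAdd (Finsupp.single e 1)

lemma ab_letter {E : Type*} (p : E × Bool) :
    toAdd (ab (letter p)) = Finsupp.single p.1 (sgn p.2) := by
  obtain ⟨e, b⟩ := p
  cases b
  · simp [letter_false, ab, sgn]
  · simp [letter_true, ab, sgn]

lemma ab_path {E : Type*} (a : ℕ → E × Bool) (n : ℕ) :
    toAdd (ab (path a n)) = ∑ i ∈ Finset.range n, Finsupp.single (a i).1 (sgn (a i).2) := by
  induction n with
  | zero => simp
  | succ n ih => rw [path_succ, map_mul, toAdd_mul, ih, ab_letter, Finset.sum_range_succ]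

lemma ab_shift (q : Q) (x : FreeGroup (α × Q)) :
    toAdd (ab (shift q x)) = tr q (toAdd (ab x)) := by
  have : ab.comp (shift q).toMonoidHom =
      (AddMonoidHom.toMultiplicative (tr (α := α) q).toAddMonoidHom).comp ab := by
    ext p : 1
    simp [ab, tr, Prod.map]
  exact congrArg toAdd (DFunLike.congr_fun this x)

lemma mem_commutator_of_ab {E : Type*} {x : FreeGroup E} (h : toAdd (ab x) = 0) :
    x ∈ ⁅(⊤ : Subgroup (FreeGroup E)), (⊤ : Subgroup (FreeGroup E))⁆ := by
  let ι : (E →₀ ℤ) →+ Additive (Abelianization (FreeGroup E)) :=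
    Finsupp.liftAddHom fun e =>
      (zmultiplesHom _ (Additive.ofMul (Abelianization.of (FreeGroup.of e))))
  have h1 : (AddMonoidHom.toMultiplicativeLeft ι).comp ab = Abelianization.of := by
    ext e
    simp [ab, ι]
  have h2 : Abelianization.of x = 1 := by
    rw [← h1, MonoidHom.comp_apply, show ab x = 1 from h, map_one]
  rw [← commutator_def, ← Abelianization.ker_of]
  exact h2

/-- The one-chain in the Cayley graph of `Q` traced out by an element of the free group. -/
noncomputable def chain (f : FreeGroup α →* Q) (g : FreeGroup α) : α × Q →₀ ℤ :=
  toAdd (ab (lam f g))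

@[simp] lemma chain_one (f : FreeGroup α →* Q) : chain f 1 = 0 := by simp [chain]

lemma chain_mul (f : FreeGroup α →* Q) (g h : FreeGroup α) :
    chain f (g * h) = chain f g + tr (f g) (chain f h) := by
  rw [chain, lam_mul, map_mul, toAdd_mul, ab_shift]
  rfl

@[simp] lemma tr_one (x : α × Q →₀ ℤ) : tr 1 x = x := by
  ext p
  simp [tr_apply]

lemma tr_tr (q r : Q) (x : α × Q →₀ ℤ) : tr q (tr r x) = tr (q * r) x := by
  ext p
  simp [tr_apply, mul_assoc]

lemma chain_inv (f : FreeGroup α →* Q) (g : FreeGroup α) :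
    chain f g⁻¹ = - tr (f g)⁻¹ (chain f g) := by
  rw [chain, lam_inv, ab_shift]
  simp [chain]

lemma chain_path (f : FreeGroup α →* Q) (a : ℕ → α × Bool) (n : ℕ) :
    chain f (path a n) =
      ∑ i ∈ Finset.range n, Finsupp.single (lseq f a i).1 (sgn (a i).2) := by
  rw [chain, lam_path, ab_path]
  rfl

lemma chain_mul_of_ker (f : FreeGroup α →* Q) {g : FreeGroup α} (hg : f g = 1)
    (h : FreeGroup α) : chain f (g * h) = chain f g + chain f h := by
  rw [chain_mul, hg, tr_one]

lemma chain_conj (f : FreeGroup α →* Q) (g : FreeGroup α) {h : FreeGroup α} (hh : f h = 1) :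
    chain f (g * h * g⁻¹) = tr (f g) (chain f h) := by
  rw [chain_mul, chain_mul, chain_inv, map_mul, hh, mul_one, map_neg, tr_tr]
  simp

/-- The chain as a homomorphism on the kernel. -/
noncomputable def chainKer (f : FreeGroup α →* Q) : f.ker →* Multiplicative (α × Q →₀ ℤ) where
  toFun g := ofAdd (chain f g)
  map_one' := by simp
  map_mul' g h := by
    rw [Subgroup.coe_mul, chain_mul_of_ker f g.2, ofAdd_add]

lemma chain_pow_of_ker (f : FreeGroup α →* Q) {g : FreeGroup α} (hg : f g = 1) (k : ℕ) :
    chain f (g ^ k) = k • chain f g := by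
  have := map_pow (chainKer f) ⟨g, hg⟩ k
  exact congrArg toAdd this

lemma chain_inv_of_ker (f : FreeGroup α →* Q) {g : FreeGroup α} (hg : f g = 1) :
    chain f g⁻¹ = - chain f g := by
  rw [chain_inv, hg]
  simp

lemma chain_eq_zero_of_mem (f : FreeGroup α →* Q) {g : FreeGroup α}
    (hg : g ∈ ⁅f.ker, f.ker⁆) : chain f g = 0 := by
  have : ⁅f.ker, f.ker⁆ ≤ (chainKer f).ker.map f.ker.subtype := by
    rw [Subgroup.commutator_le]
    intro x hx y hy
    refine ⟨⟨x, hx⟩ * ⟨y, hy⟩ * ⟨x, hx⟩⁻¹ * ⟨y, hy⟩⁻¹, ?_, rfl⟩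
    show chainKer f _ = 1
    rw [map_mul, map_mul, map_mul, map_inv, map_inv, mul_right_comm, mul_inv_cancel_right,
      mul_inv_cancel]
  obtain ⟨x, hx, rfl⟩ := this hg
  exact congrArg toAdd (show chainKer f x = 1 from hx)

lemma chain_mem_span (f : FreeGroup α →* Q) {w n : FreeGroup α} (hw : f w = 1)
    (hn : n ∈ Subgroup.normalClosure {w}) :
    chain f n ∈ Submodule.span ℤ (Set.range fun q => tr q (chain f w)) := by
  have hker : ∀ x ∈ Subgroup.normalClosure {w}, f x = 1 := fun x hx =>
    normalClosure_le_ker hw hx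
  rw [Subgroup.normalClosure] at hn hker
  induction hn using Subgroup.closure_induction with
  | mem x hx =>
    obtain ⟨y, hy, hyx⟩ := Group.mem_conjugatesOfSet_iff.1 hx
    obtain ⟨g, rfl⟩ := isConj_iff.1 hyx
    rw [Set.mem_singleton_iff.1 hy, chain_conj f g hw]
    exact Submodule.subset_span ⟨_, rfl⟩
  | one => simp
  | mul x y hx _ h1 h2 =>
    rw [chain_mul_of_ker f (hker x hx)]
    exact Submodule.add_mem _ h1 h2
  | inv x hx h1 =>
    rw [chain_inv_of_ker f (hker x hx)]
    exact Submodule.neg_mem _ h1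

/-- The loop in the free group obtained from a path in the Cayley graph and a section. -/
def sec (f : FreeGroup α →* Q) (τ : Q → FreeGroup α) : FreeGroup (α × Q) →* FreeGroup α :=
  FreeGroup.lift fun p => τ p.2 * FreeGroup.of p.1 * (τ (p.2 * f (FreeGroup.of p.1)))⁻¹

lemma sec_shift_lam (f : FreeGroup α →* Q) (τ : Q → FreeGroup α) (g : FreeGroup α) :
    ∀ q, sec f τ (shift q (lam f g)) = τ q * g * (τ (q * f g))⁻¹ := by
  induction g using FreeGroup.induction_on with
  | C1 => simp
  | of x => simp [lam_of, sec]
  | inv_of x h =>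
    intro q
    have := h (q * (f (FreeGroup.of x))⁻¹)
    rw [lam_inv, ← MulAut.mul_apply, ← map_mul, map_inv, map_inv, this]
    simp [mul_assoc]
  | mul x y hx hy =>
    intro q
    rw [lam_mul, map_mul, map_mul, hx, ← MulAut.mul_apply, ← map_mul, hy, map_mul]
    group

/-- The Magnus embedding theorem: an element of the kernel with trivial chain is a product of
commutators of elements of the kernel. -/
theorem mem_commutator_of_chain {f : FreeGroup α →* Q} (hf : Function.Surjective f)
    {v : FreeGroup α} (hv : f v = 1) (h : chain f v = 0) : v ∈ ⁅f.ker, f.ker⁆ := by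
  choose τ hτ using hf
  have h1 : sec f τ (lam f v) ∈ ⁅f.ker, f.ker⁆ := by
    have h2 := Subgroup.mem_map_of_mem (sec f τ) (mem_commutator_of_ab h)
    rw [Subgroup.map_commutator] at h2
    have h3 : (⊤ : Subgroup (FreeGroup (α × Q))).map (sec f τ) ≤ f.ker := by
      rw [← MonoidHom.range_eq_map, MonoidHom.range_le_ker_iff]
      ext p
      simp [sec, hτ]
    exact Subgroup.commutator_mono h3 h3 h2
  have h4 := sec_shift_lam f τ v 1
  rw [map_one, MulAut.one_apply, one_mul, hv] at h4
  rw [h4] at h1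
  have := (Subgroup.commutator_normal f.ker f.ker).conj_mem _ h1 (τ 1)⁻¹
  simpa [mul_assoc] using this

/-- Projection of edges along a homomorphism. -/
def edgeMap {Q' : Type*} [Group Q'] (π : Q' →* Q) : α × Q' → α × Q := Prod.map id π

lemma chain_comp {Q' : Type*} [Group Q'] (π : Q' →* Q) (f : FreeGroup α →* Q')
    (g : FreeGroup α) :
    chain (π.comp f) g = (chain f g).mapDomain (edgeMap π) := by
  have htr : ∀ (q : Q') (x : α × Q' →₀ ℤ),
      (tr q x).mapDomain (edgeMap π) = tr (π q) (x.mapDomain (edgeMap π)) := by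
    intro q x
    induction x using Finsupp.induction_linear with
    | zero => simp
    | add x y hx hy => rw [map_add, Finsupp.mapDomain_add, hx, hy, Finsupp.mapDomain_add, map_add]
    | single p n => simp [tr, Finsupp.mapDomain_single, edgeMap, Prod.map]
  induction g using FreeGroup.induction_on with
  | C1 => simp
  | of x => simp [chain, lam_of, ab, Finsupp.mapDomain_single, edgeMap]
  | inv_of x h =>
    have hneg : ∀ y : α × Q' →₀ ℤ,
        (-y).mapDomain (edgeMap π) = -(y.mapDomain (edgeMap π) : α × Q →₀ ℤ) :=
      map_neg (Finsupp.mapDomain.addMonoidHom (edgeMap π))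
    rw [chain_inv, h, chain_inv, hneg, htr, MonoidHom.comp_apply, map_inv]
  | mul x y hx hy => rw [chain_mul, chain_mul, hx, hy, Finsupp.mapDomain_add, htr]; rfl

/-- The boundary of a one-chain in the Cayley graph. -/
noncomputable def bdry (f : FreeGroup α →* Q) : (α × Q →₀ ℤ) →+ (Q →₀ ℤ) :=
  Finsupp.liftAddHom fun p => Finsupp.singleAddHom (p.2 * f (FreeGroup.of p.1)) -
    Finsupp.singleAddHom p.2

lemma bdry_chain_path (f : FreeGroup α →* Q) (a : ℕ → α × Bool) (n : ℕ) :
    bdry f (chain f (path a n)) = Finsupp.single (f (path a n)) 1 - Finsupp.single 1 1 := by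
  induction n with
  | zero => simp
  | succ n ih =>
    rw [chain_path, Finset.sum_range_succ, ← chain_path, map_add, ih, path_succ, map_mul]
    obtain ⟨⟨x, b⟩, h⟩ : ∃ p, a n = p := ⟨_, rfl⟩
    cases b
    · have : bdry f (Finsupp.single (x, f (path a n) * f (letter (x, false))) (-1)) =
          Finsupp.single (f (path a n) * f (letter (x, false))) 1 -
            Finsupp.single (f (path a n)) 1 := by
        rw [bdry, Finsupp.liftAddHom_apply_single]
        simp [letter_false]
        abel
      simp only [lseq, edge, h, sgn, Bool.false_eq_true, if_false, this]
      abel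
    · simp [bdry, lseq, edge, h, sgn, letter_true]

end OneRelator

namespace OneRelator

open Multiplicative

universe u

variable {G : Type*} [Group G]

lemma mem_ratDerived_succ {i : ℕ} {g : G} : g ∈ ratDerived G (i + 1) ↔
    g ∈ ratDerived G i ∧ ∃ k : ℕ, 1 ≤ k ∧ g ^ k ∈ ⁅ratDerived G i, ratDerived G i⁆ := by
  refine ⟨fun h => ?_, fun h => Subgroup.subset_closure h⟩
  change g ∈ Subgroup.closure _ at h
  induction h using Subgroup.closure_induction with
  | mem x hx => exact hx
  | one => exact ⟨Subgroup.one_mem _, 1, le_rfl, by rw [one_pow]; exact Subgroup.one_mem _⟩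
  | mul x y _ _ hx hy =>
    obtain ⟨hx, k, hk, hxk⟩ := hx
    obtain ⟨hy, l, hl, hyl⟩ := hy
    refine ⟨Subgroup.mul_mem _ hx hy, k * l, Nat.mul_pos hk hl, ?_⟩
    rw [← QuotientGroup.eq_one_iff, QuotientGroup.mk_pow] at hxk hyl ⊢
    rw [QuotientGroup.mk_mul]
    have hcomm : Commute (x : G ⧸ ⁅ratDerived G i, ratDerived G i⁆) y := by
      refine QuotientGroup.eq.2 ?_
      have := Subgroup.commutator_mem_commutator (Subgroup.inv_mem _ hy) (Subgroup.inv_mem _ hx)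
      rw [commutatorElement_def] at this
      simpa [mul_assoc] using this
    rw [hcomm.mul_pow, pow_mul, hxk, one_pow, mul_comm, pow_mul, hyl, one_pow, one_mul]
  | inv x _ hx =>
    obtain ⟨hx, k, hk, hxk⟩ := hx
    exact ⟨Subgroup.inv_mem _ hx, k, hk, by rw [inv_pow]; exact Subgroup.inv_mem _ hxk⟩

lemma ratDerived_succ_le (i : ℕ) : ratDerived G (i + 1) ≤ ratDerived G i := fun _ hg =>
  (mem_ratDerived_succ.1 hg).1

lemma ratDerived_antitone : Antitone (ratDerived G) := antitone_nat_of_succ_le ratDerived_succ_le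

lemma commutator_ratDerived_le (i : ℕ) : ⁅ratDerived G i, ratDerived G i⁆ ≤ ratDerived G (i + 1) :=
  fun g hg => mem_ratDerived_succ.2
    ⟨Subgroup.commutator_le_left _ _ hg, 1, le_rfl, by rwa [pow_one]⟩

lemma mem_ratDerived_succ_of_pow {i : ℕ} {g : G} {k : ℕ} (hk : k ≠ 0) (hg : g ∈ ratDerived G i)
    (h : g ^ k ∈ ratDerived G (i + 1)) : g ∈ ratDerived G (i + 1) := by
  obtain ⟨-, l, hl, h⟩ := mem_ratDerived_succ.1 h
  rw [← pow_mul] at h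
  exact mem_ratDerived_succ.2 ⟨hg, k * l, Nat.mul_pos (Nat.pos_of_ne_zero hk) hl, h⟩

lemma locInd_quotient (i : ℕ) : LocInd (G ⧸ ratDerived G i) := by
  induction i with
  | zero =>
    intro H _ hH
    refine absurd ?_ hH
    rw [Subgroup.eq_bot_iff_forall]
    intro x _
    obtain ⟨x, rfl⟩ := QuotientGroup.mk_surjective x
    exact (QuotientGroup.eq_one_iff x).2 (Subgroup.mem_top x)
  | succ i ih =>
    have hle := ratDerived_succ_le (G := G) i
    refine ih.of_hom (QuotientGroup.map _ _ (MonoidHom.id G) hle) ?_ ?_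
    · intro x hx y hy
      obtain ⟨x, rfl⟩ := QuotientGroup.mk_surjective x
      obtain ⟨y, rfl⟩ := QuotientGroup.mk_surjective y
      rw [MonoidHom.mem_ker] at hx hy
      have hx := (QuotientGroup.eq_one_iff x).1 hx
      have hy := (QuotientGroup.eq_one_iff y).1 hy
      refine QuotientGroup.eq.2 (commutator_ratDerived_le i ?_)
      have := Subgroup.commutator_mem_commutator (Subgroup.inv_mem _ hy) (Subgroup.inv_mem _ hx)
      rw [commutatorElement_def] at this
      simpa [mul_assoc] using this
    · intro x hx k hk h
      obtain ⟨x, rfl⟩ := QuotientGroup.mk_surjective x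
      rw [MonoidHom.mem_ker] at hx
      have hx := (QuotientGroup.eq_one_iff x).1 hx
      rw [← QuotientGroup.mk_pow] at h
      exact (QuotientGroup.eq_one_iff x).2
        (mem_ratDerived_succ_of_pow hk hx ((QuotientGroup.eq_one_iff _).1 h))

/-- A homomorphism on a subgroup compatible with a filtration respects the rational derived
series. -/
lemma map_mem_ratDerived {F B : Type*} [Group F] [Group B] {M : Subgroup F} (ψ : M →* B)
    (L : ℕ → Subgroup F) (hM : L 0 ≤ M) (hL : Antitone L)
    (h : ∀ i, ∀ g ∈ L (i + 1), ∃ k : ℕ, 1 ≤ k ∧ ∃ c ∈ ⁅L i, L i⁆, ∃ u : M, ψ u = 1 ∧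
      g ^ k = c * u) (i : ℕ) : ∀ x : M, (x : F) ∈ L i → ψ x ∈ ratDerived B i := by
  induction i with
  | zero => exact fun x _ => Subgroup.mem_top _
  | succ i ih =>
    intro x hx
    refine mem_ratDerived_succ.2 ⟨ih x (hL (Nat.le_succ i) hx), ?_⟩
    obtain ⟨k, hk, c, hc, u, hu, hxk⟩ := h i x hx
    have hle : ⁅L i, L i⁆ ≤ (⁅ratDerived B i, ratDerived B i⁆.comap ψ).map M.subtype := by
      rw [Subgroup.commutator_le]
      intro y hy z hz
      have hyM := hM (hL (Nat.zero_le i) hy)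
      have hzM := hM (hL (Nat.zero_le i) hz)
      refine ⟨⟨y, hyM⟩ * ⟨z, hzM⟩ * ⟨y, hyM⟩⁻¹ * ⟨z, hzM⟩⁻¹, ?_, rfl⟩
      have := Subgroup.commutator_mem_commutator (ih ⟨y, hyM⟩ hy) (ih ⟨z, hzM⟩ hz)
      rw [commutatorElement_def] at this
      simpa only [SetLike.mem_coe, Subgroup.mem_comap, map_mul, map_inv] using this
    obtain ⟨d, hd, rfl⟩ := hle hc
    refine ⟨k, hk, ?_⟩
    have h1 : x ^ k = d * u := Subtype.ext hxk
    rw [← map_pow, h1, map_mul, hu, mul_one]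
    exact hd

/-- Finitely many decreasing sequences of propositions are simultaneously stable from some point
on. -/
lemma exists_stable {ι : Type*} (s : Finset ι) (P : ℕ → ι → Prop)
    (hP : ∀ i m m', m ≤ m' → P m' i → P m i) :
    ∃ m, ∀ i ∈ s, P m i → ∀ m', P m' i := by
  classical
  induction s using Finset.induction_on with
  | empty => exact ⟨0, by simp⟩
  | insert a s _ ih =>
    obtain ⟨m, hm⟩ := ih
    by_cases ha : ∀ m', P m' a
    · refine ⟨m, fun i hi => ?_⟩
      rcases Finset.mem_insert.1 hi with rfl | hi
      · exact fun _ => ha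
      · exact hm i hi
    · push Not at ha
      obtain ⟨l, hl⟩ := ha
      refine ⟨max m l, fun i hi h => ?_⟩
      rcases Finset.mem_insert.1 hi with rfl | hi
      · exact absurd (hP i l _ (le_max_right m l) h) hl
      · exact hm i hi (hP i m _ (le_max_left m l) h)

variable {α : Type u}

/-- The covering of the rose with deck group `G ⧸ D^i(G)`. -/
def cov (p : FreeGroup α →* G) (i : ℕ) : FreeGroup α →* G ⧸ ratDerived G i :=
  (QuotientGroup.mk' _).comp p

lemma cov_eq_one {p : FreeGroup α →* G} {i : ℕ} {g : FreeGroup α} :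
    cov p i g = 1 ↔ p g ∈ ratDerived G i := QuotientGroup.eq_one_iff _

lemma cov_eq_one_of_le {p : FreeGroup α →* G} {i j : ℕ} (hij : i ≤ j) {g : FreeGroup α}
    (h : cov p j g = 1) : cov p i g = 1 :=
  cov_eq_one.2 (ratDerived_antitone hij (cov_eq_one.1 h))

lemma cov_surjective {p : FreeGroup α →* G} (hp : Function.Surjective p) (i : ℕ) :
    Function.Surjective (cov p i) :=
  (QuotientGroup.mk'_surjective _).comp hp

lemma cov_eq_cov {p : FreeGroup α →* G} {i : ℕ} {g h : FreeGroup α} :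
    cov p i g = cov p i h ↔ cov p i (g⁻¹ * h) = 1 := by
  rw [map_mul, map_inv, inv_mul_eq_one]

/-- Elements of the next term of the rational derived series, seen in the free group. -/
lemma exists_pow_of_cov_succ {p : FreeGroup α →* G} (hp : Function.Surjective p) {i : ℕ}
    {g : FreeGroup α} (h : cov p (i + 1) g = 1) :
    ∃ k : ℕ, 1 ≤ k ∧ ∃ c ∈ ⁅(cov p i).ker, (cov p i).ker⁆, ∃ n ∈ p.ker, g ^ k = c * n := by
  obtain ⟨-, k, hk, h⟩ := mem_ratDerived_succ.1 (cov_eq_one.1 h)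
  have h1 : ratDerived G i = (cov p i).ker.map p := by
    have : (cov p i).ker = (ratDerived G i).comap p := by
      ext x
      exact cov_eq_one
    rw [this, Subgroup.map_comap_eq_self_of_surjective hp]
  rw [h1, ← Subgroup.map_commutator] at h
  obtain ⟨c, hc, hck⟩ := h
  refine ⟨k, hk, c, hc, c⁻¹ * g ^ k, ?_, by group⟩
  rw [MonoidHom.mem_ker, map_mul, map_inv, hck, map_pow, inv_mul_cancel]

lemma start_eq {Q : Type*} [Group Q] {f : FreeGroup α →* Q} {q q' : Q} {p p' : α × Bool}
    (h : edge f q p = edge f q' p') :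
    (p = p' ∧ q = q') ∨
      (p' = inv p ∧ q' = q * f (letter p) ∧ q = q' * f (letter p')) := by
  obtain ⟨x, b⟩ := p
  obtain ⟨x', b'⟩ := p'
  obtain ⟨rfl, h⟩ := Prod.ext_iff.1 h
  cases b <;> cases b' <;> simp [edge, inv, letter_false, letter_true] at h ⊢
  · exact h
  · simp [← h]
  · simp [h]
  · exact h

/-- Free groups are residually `ℚ`-solvable. -/
theorem ratDerivedOmega_freeGroup : ratDerivedOmega (FreeGroup α) = ⊥ := by
  classical
  rw [Subgroup.eq_bot_iff_forall]
  intro w hw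
  by_contra hw1
  have hL : w.toWord ≠ [] := by simpa using hw1
  obtain ⟨a, -, haw, hai⟩ := exists_seq_of_list hL
  rw [FreeGroup.mk_toWord] at haw
  set n := w.toWord.length with hn
  have hred : ∀ i, i + 1 < n → a (i + 1) ≠ inv (a i) := by
    intro i hi h
    have h1 := FreeGroup.isReduced_toWord (x := w)
    rw [FreeGroup.IsReduced, List.isChain_iff_getElem] at h1
    have h2 := h1 i hi
    rw [← hai _ hi, ← hai i (by omega), h] at h2
    simp [inv] at h2
  let f : ∀ m, FreeGroup α →* FreeGroup α ⧸ ratDerived (FreeGroup α) m :=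
    fun m => cov (MonoidHom.id _) m
  obtain ⟨m, hm⟩ := exists_stable (Finset.range (n + 1) ×ˢ Finset.range (n + 1))
    (fun m ij => f m (path a ij.1) = f m (path a ij.2)) (by
      intro ij m m' hmm h
      exact cov_eq_cov.2 (cov_eq_one_of_le hmm (cov_eq_cov.1 h)))
  have hex : ∃ l, 0 < l ∧ ∃ i, i + l ≤ n ∧ f m (path a i) = f m (path a (i + l)) := by
    refine ⟨n, List.length_pos_of_ne_nil hL, 0, by omega, ?_⟩
    rw [zero_add, haw, path_zero, map_one]
    exact (cov_eq_one.2 ((Subgroup.mem_iInf.1 hw) m)).symm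
  obtain ⟨hl, i, hi, hil⟩ := Nat.find_spec hex
  have hmin := fun l hl => Nat.find_min hex (m := l) hl
  set l := Nat.find hex
  let b : ℕ → α × Bool := fun t => a (i + t)
  have hb : ∀ t, f m (path a (i + t)) = f m (path a i) * f m (path b t) := fun t => by
    rw [path_add, map_mul]
  have hstab := hm (i, i + l) (by simp; omega) hil (m + 1)
  have hbl : ∀ m', f m' (path a i) = f m' (path a (i + l)) → f m' (path b l) = 1 := by
    intro m' h
    rw [path_add, map_mul] at h
    exact left_eq_mul.1 h
  obtain ⟨k, hk, c, hc, u, hu, hcu⟩ := exists_pow_of_cov_succ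
    (p := MonoidHom.id (FreeGroup α)) Function.surjective_id (hbl _ hstab)
  rw [show u = 1 from hu, mul_one] at hcu
  have h0 := chain_eq_zero_of_mem _ hc
  rw [← hcu, chain_pow_of_ker _ (hbl _ hil)] at h0
  have h0 : chain (f m) (path b l) = 0 := by
    rcases smul_eq_zero.1 h0 with h | h
    · omega
    · exact h
  rw [chain_path] at h0
  have h1 := DFunLike.congr_fun h0 (lseq (f m) b 0).1
  rw [Finsupp.finsetSum_apply, Finset.sum_eq_single 0] at h1
  · rw [Finsupp.single_eq_same, sgn] at h1
    split_ifs at h1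
    simp at h1
  · intro t ht ht0
    rw [Finset.mem_range] at ht
    refine Finsupp.single_eq_of_ne ?_
    intro heq
    have hdist : ∀ s t, s < t → t ≤ l → t - s < l → f m (path b s) ≠ f m (path b t) := by
      intro s t hst htl hlt h
      refine hmin (t - s) hlt ⟨by omega, i + s, by omega, ?_⟩
      rw [show i + s + (t - s) = i + t by omega, hb, hb, h]
    rcases start_eq heq with ⟨-, h⟩ | ⟨h1, h2, h3⟩
    · exact hdist 0 t (by omega) ht.le (by omega) h
    · rw [← map_mul, ← path_succ] at h2 h3
      by_cases ht1 : t = 1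
      · subst ht1
        exact hred i (by omega) h1
      · exact hdist 1 t (by omega) ht.le (by omega) h2.symm
  · intro h
    exact absurd (Finset.mem_range.2 hl) h

end OneRelator

namespace OneRelator

open Multiplicative

universe u

variable {α Q : Type u} [Group Q]

/-- Tietze elimination of generators along a well-founded relation. -/
lemma exists_elimination {X : Type*} {Q : Type*} {e : Q → X} (he : Function.Injective e)
    {C : Q → FreeGroup X} {r : Q → Q → Prop} (hr : WellFounded r)
    (hC : ∀ q, C q ∈ Subgroup.closure (FreeGroup.of '' {y | ∀ q', y = e q' → r q' q})) :
    ∃ Ψ : FreeGroup X →* FreeGroup X, (∀ q, Ψ (FreeGroup.of (e q)) = Ψ (C q)) ∧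
      ∀ {H : Type u} [Group H] (κ : FreeGroup X →* H),
        (∀ q, κ (FreeGroup.of (e q)) = κ (C q)) → ∀ x, κ (Ψ x) = κ x := by
  classical
  let T : Q → FreeGroup X := hr.fix fun q ih => FreeGroup.lift (fun y =>
    if h : ∃ q', y = e q' ∧ r q' q then ih h.choose h.choose_spec.2 else FreeGroup.of y) (C q)
  let Ψ : FreeGroup X →* FreeGroup X := FreeGroup.lift fun y =>
    if h : ∃ q', y = e q' then T h.choose else FreeGroup.of y
  have hΨe : ∀ q, Ψ (FreeGroup.of (e q)) = T q := by
    intro q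
    have h : ∃ q', e q = e q' := ⟨q, rfl⟩
    rw [FreeGroup.lift_apply_of, dif_pos h, he h.choose_spec.symm]
  have hΨn : ∀ y, (¬ ∃ q', y = e q') → Ψ (FreeGroup.of y) = FreeGroup.of y := by
    intro y h
    rw [FreeGroup.lift_apply_of, dif_neg h]
  have hT : ∀ q, T q = Ψ (C q) := by
    intro q
    rw [show T q = _ from hr.fix_eq _ q]
    refine MonoidHom.eqOn_closure (g := Ψ) ?_ (hC q)
    rintro _ ⟨y, hy, rfl⟩
    rw [FreeGroup.lift_apply_of]
    by_cases h : ∃ q', y = e q'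
    · obtain ⟨q', rfl⟩ := h
      have h2 : ∃ q'', e q' = e q'' ∧ r q'' q := ⟨q', rfl, hy q' rfl⟩
      rw [dif_pos h2, hΨe]
      exact congrArg T (he h2.choose_spec.1.symm)
    · rw [hΨn y h, dif_neg]
      rintro ⟨q', h1, -⟩
      exact h ⟨q', h1⟩
  refine ⟨Ψ, fun q => by rw [hΨe, hT], fun {H} _ κ hκ => ?_⟩
  have hκT : ∀ q, κ (T q) = κ (FreeGroup.of (e q)) := by
    intro q
    induction q using hr.induction with
    | _ q ih =>
    rw [hT, hκ]
    refine MonoidHom.eqOn_closure (f := κ.comp Ψ) (g := κ) ?_ (hC q)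
    rintro _ ⟨y, hy, rfl⟩
    by_cases h : ∃ q', y = e q'
    · obtain ⟨q', rfl⟩ := h
      rw [MonoidHom.comp_apply, hΨe, ih q' (hy q' rfl)]
    · rw [MonoidHom.comp_apply, hΨn y h]
  have : κ.comp Ψ = κ := by
    ext y
    by_cases h : ∃ q', y = e q'
    · obtain ⟨q', rfl⟩ := h
      rw [MonoidHom.comp_apply, hΨe, hκT]
    · rw [MonoidHom.comp_apply, hΨn y h]
  exact fun x => DFunLike.congr_fun this x

lemma exists_solution {X : Type*} (b : ℕ → X × Bool) {n i : ℕ} (hi : i < n) :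
    ∃ C ∈ Subgroup.closure (FreeGroup.of '' {y | ∃ j < n, j ≠ i ∧ (b j).1 = y}),
      ∀ {H : Type u} [Group H] (κ : FreeGroup X →* H),
        κ (path b n) = 1 ↔ κ (FreeGroup.of (b i).1) = κ C := by
  obtain ⟨m, rfl⟩ : ∃ m, n = i + 1 + m := ⟨n - (i + 1), by omega⟩
  have hx : path b i ∈ Subgroup.closure
      (FreeGroup.of '' {y | ∃ j < i + 1 + m, j ≠ i ∧ (b j).1 = y}) :=
    path_mem fun j hj => ⟨j, by omega, by omega, rfl⟩
  have hy : path (fun j => b (i + 1 + j)) m ∈ Subgroup.closure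
      (FreeGroup.of '' {y | ∃ j < i + 1 + m, j ≠ i ∧ (b j).1 = y}) :=
    path_mem fun j hj => ⟨i + 1 + j, by omega, by omega, rfl⟩
  rw [path_add, path_succ]
  set x := path b i
  set y := path (fun j => b (i + 1 + j)) m
  obtain ⟨⟨e, s⟩, h⟩ : ∃ p, b i = p := ⟨_, rfl⟩
  rw [h]
  cases s
  · refine ⟨y * x, Subgroup.mul_mem _ hy hx, fun {H} _ κ => ?_⟩
    simp only [letter_false, map_mul, map_inv]
    rw [mul_eq_one_iff_eq_inv, mul_inv_eq_iff_eq_mul, eq_comm, inv_mul_eq_iff_eq_mul]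
  · refine ⟨x⁻¹ * y⁻¹, Subgroup.mul_mem _ (Subgroup.inv_mem _ hx) (Subgroup.inv_mem _ hy),
      fun {H} _ κ => ?_⟩
    simp only [letter_true, map_mul, map_inv]
    rw [mul_eq_one_iff_eq_inv, ← eq_inv_mul_iff_mul_eq]

lemma shift_path (q : Q) (c : ℕ → (α × Q) × Bool) (n : ℕ) :
    shift q (path c n) = path (fun i => (((c i).1.1, q * (c i).1.2), (c i).2)) n := by
  induction n with
  | zero => simp
  | succ n ih =>
    rw [path_succ, map_mul, ih, path_succ]
    exact congrArg _ (shift_letter q (c n).1 (c n).2)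

/-- If a loop traverses pairwise distinct edges of the Cayley graph of a locally indicable group,
then the subgroup of the free group defining the Cayley graph, modulo the normal closure of the
loop, embeds into a free group. -/
theorem exists_hom_ker_eq_normalClosure {f : FreeGroup α →* Q} (hQ : LocInd Q)
    (hf : Function.Surjective f) {a : ℕ → α × Bool} {p : ℕ} (hp : 0 < p) (h1 : f (path a p) = 1)
    (hdist : ∀ i < p, ∀ j < p, (lseq f a i).1 = (lseq f a j).1 → i = j) :
    ∃ ψ : f.ker →* FreeGroup (α × Q), ∀ x : f.ker,
      ψ x = 1 ↔ (x : FreeGroup α) ∈ Subgroup.normalClosure {path a p} := by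
  classical
  set R := Subgroup.normalClosure {path a p}
  let s := (a 0).1
  let A : Finset Q := ((Finset.range p).filter fun i => (a i).1 = s).image
    fun i => (lseq f a i).1.2
  have hA : ∀ q, q ∈ A ↔ ∃ i < p, (lseq f a i).1 = (s, q) := by
    intro q
    simp only [A, Finset.mem_image, Finset.mem_filter, Finset.mem_range]
    constructor
    · rintro ⟨i, ⟨hi, h⟩, rfl⟩
      exact ⟨i, hi, Prod.ext h rfl⟩
    · rintro ⟨i, hi, h⟩
      have h1 : (lseq f a i).1.1 = s := congrArg Prod.fst h
      exact ⟨i, ⟨hi, h1⟩, congrArg Prod.snd h⟩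
  obtain ⟨c, hcA, hwf⟩ := hQ.exists_choice _ A
    ⟨_, (hA _).2 ⟨0, hp, rfl⟩⟩ le_rfl
  let e : Q → α × Q := fun q => (s, q * c q)
  have he : Function.Injective e := by
    intro q q' h
    by_contra hne
    have h2 : q * c q = q' * c q' := congrArg Prod.snd h
    have h3 := hwf.asymmetric q q' ⟨hne, c q', hcA q', h2⟩
    exact h3 ⟨fun h => hne h.symm, c q, hcA q, h2.symm⟩
  choose i hip hi using fun q => (hA (c q)).1 (hcA q)
  let b : Q → ℕ → (α × Q) × Bool := fun q j =>
    (((lseq f a j).1.1, q * (lseq f a j).1.2), (lseq f a j).2)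
  have hb : ∀ q, shift q (lam f (path a p)) = path (b q) p := fun q => by
    rw [lam_path, shift_path]
  have hbi : ∀ q, (b q (i q)).1 = e q := fun q => by
    show ((lseq f a (i q)).1.1, q * (lseq f a (i q)).1.2) = _
    rw [hi]
  choose C hC hCκ using fun q => exists_solution.{u} (b q) (hip q)
  obtain ⟨Ψ, hΨ, hκ⟩ := exists_elimination.{u} he hwf (C := C) (by
    intro q
    refine Subgroup.closure_mono (Set.image_mono ?_) (hC q)
    rintro _ ⟨j, hj, hji, rfl⟩ q' h
    have h2 : (lseq f a j).1.1 = s := congrArg Prod.fst h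
    have h3 : q * (lseq f a j).1.2 = q' * c q' := congrArg Prod.snd h
    refine ⟨?_, _, (hA _).2 ⟨j, hj, Prod.ext h2 rfl⟩, h3.symm⟩
    rintro rfl
    refine hji (hdist j hj _ (hip _) ?_)
    rw [hi]
    exact Prod.ext h2 (mul_left_cancel h3))
  have hΨ1 : ∀ q, Ψ (path (b q) p) = 1 := fun q => (hCκ q Ψ).2 (by rw [hbi, hΨ])
  refine ⟨MonoidHom.mk' (fun x => Ψ (lam f x)) ?_, fun x => ⟨fun hx => ?_, fun hx => ?_⟩⟩
  · rintro ⟨x, hx⟩ ⟨y, hy⟩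
    show Ψ (lam f (x * y)) = _
    rw [lam_mul, show f x = 1 from hx, map_one, MulAut.one_apply, map_mul]
  · change Ψ (lam f x) = 1 at hx
    choose τ hτ using hf
    have hsec : ∀ q g, sec f τ (shift q (lam f g)) = τ q * g * (τ (q * f g))⁻¹ :=
      fun q g => sec_shift_lam f τ g q
    have h2 := hκ ((QuotientGroup.mk' R).comp (sec f τ)) (by
      intro q
      rw [← hbi, ← hCκ, ← hb, MonoidHom.comp_apply, hsec, h1, mul_one]
      exact (QuotientGroup.eq_one_iff _).2 (Subgroup.normalClosure_normal.conj_mem _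
        (Subgroup.subset_normalClosure (Set.mem_singleton _)) _)) (lam f x)
    rw [hx, map_one] at h2
    have h3 := hsec 1 x
    rw [map_one, MulAut.one_apply, show f x = 1 from x.2, mul_one] at h3
    rw [MonoidHom.comp_apply, h3] at h2
    have h4 : τ 1 * (x : FreeGroup α) * (τ 1)⁻¹ ∈ R := (QuotientGroup.eq_one_iff _).1 h2.symm
    have h5 := Subgroup.normalClosure_normal.conj_mem _ h4 (τ 1)⁻¹
    simpa [mul_assoc] using h5
  · have key : ∀ v ∈ R, f v = 1 ∧ ∀ q, Ψ (shift q (lam f v)) = 1 := by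
      intro v hv
      refine ⟨normalClosure_le_ker h1 hv, ?_⟩
      have hR : R = Subgroup.closure (Group.conjugatesOfSet {path a p}) := rfl
      rw [hR] at hv
      induction hv using Subgroup.closure_induction with
      | mem x hx =>
        obtain ⟨_, h, hx⟩ := Group.mem_conjugatesOfSet_iff.1 hx
        rw [Set.mem_singleton_iff] at h
        subst h
        obtain ⟨g, rfl⟩ := isConj_iff.1 hx
        intro q
        have h4 : shift q (shift (f g) (lam f (path a p))) = path (b (q * f g)) p := by
          rw [← hb, map_mul, MulAut.mul_apply]
        rw [lam_mul, lam_mul, map_mul, map_mul, map_mul, map_mul, h4, hΨ1, mul_one, ← map_mul,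
          ← map_mul, map_mul f, h1, mul_one, ← lam_mul, mul_inv_cancel, lam_one, map_one, map_one]
      | one => simp
      | mul x y hx hy ihx ihy =>
        intro q
        rw [lam_mul, map_mul, map_mul, ihx, one_mul, ← MulAut.mul_apply, ← map_mul, ihy]
      | inv x hx ihx =>
        intro q
        rw [lam_inv, ← MulAut.mul_apply, ← map_mul, map_inv, map_inv, ihx, inv_one]
    have := (key x hx).2 1
    rwa [map_one, MulAut.one_apply] at this

end OneRelator

namespace OneRelator

open Multiplicative

universe u

variable {α Q : Type u} [Group Q]

/-- The signed letter of an edge oriented by the sign of its coefficient in a chain. -/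
def oletter (c : α × Q →₀ ℤ) (e : α × Q) : α × Bool := (e.1, decide (0 < c e))

/-- The initial vertex of an edge oriented by the sign of its coefficient in a chain. -/
def otail (f : FreeGroup α →* Q) (c : α × Q →₀ ℤ) (e : α × Q) : Q :=
  if 0 < c e then e.2 else e.2 * f (FreeGroup.of e.1)

/-- The terminal vertex of an edge oriented by the sign of its coefficient in a chain. -/
def ohead (f : FreeGroup α →* Q) (c : α × Q →₀ ℤ) (e : α × Q) : Q :=
  otail f c e * f (letter (oletter c e))

lemma edge_otail (f : FreeGroup α →* Q) (c : α × Q →₀ ℤ) (e : α × Q) :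
    edge f (otail f c e) (oletter c e) = e := by
  by_cases h : 0 < c e <;> simp [edge, otail, oletter, h, letter_false]

lemma edge_inv (f : FreeGroup α →* Q) (q : Q) (p : α × Bool) :
    edge f (q * f (letter p)) (inv p) = edge f q p := by
  obtain ⟨x, b⟩ := p
  cases b <;> simp [edge, inv, letter_false, letter_true]

/-- A simple cycle in the support of a chain, compatible with its orientation. -/
structure SimpleCycle (f : FreeGroup α →* Q) (c : α × Q →₀ ℤ) (l : ℕ) (e : ℕ → α × Q) : Prop where
  pos : 0 < l
  period : ∀ t, e (t + l) = e t
  ne_zero : ∀ t, c (e t) ≠ 0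
  next : ∀ t, otail f c (e (t + 1)) = ohead f c (e t)
  inj : ∀ s < l, ∀ t < l, otail f c (e s) = otail f c (e t) → s = t

lemma exists_next {f : FreeGroup α →* Q} {c : α × Q →₀ ℤ} (hc : bdry f c = 0) {e : α × Q}
    (he : c e ≠ 0) : ∃ e', c e' ≠ 0 ∧ otail f c e' = ohead f c e := by
  classical
  by_contra! hne
  have h1 : bdry f c = ∑ x ∈ c.support,
      (Finsupp.single (ohead f c x) |c x| - Finsupp.single (otail f c x) |c x|) := by
    rw [bdry, Finsupp.liftAddHom_apply, Finsupp.sum]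
    refine Finset.sum_congr rfl fun x hx => ?_
    by_cases h : 0 < c x
    · simp [ohead, otail, oletter, h, abs_of_pos h, letter_true]
    · simp [ohead, otail, oletter, h, abs_of_nonpos (not_lt.1 h), letter_false]
      abel
  have h2 := DFunLike.congr_fun (h1.symm.trans hc) (ohead f c e)
  rw [Finsupp.finsetSum_apply] at h2
  refine absurd h2 (ne_of_gt (Finset.sum_pos' ?_ ⟨e, Finsupp.mem_support_iff.2 he, ?_⟩))
  · intro x hx
    rw [Finsupp.sub_apply, Finsupp.single_eq_of_ne (hne x (Finsupp.mem_support_iff.1 hx)).symm,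
      sub_zero, Finsupp.single_apply]
    split_ifs <;> simp
  · rw [Finsupp.sub_apply, Finsupp.single_eq_of_ne (hne e he).symm, sub_zero,
      Finsupp.single_eq_same]
    exact abs_pos.2 he

/-- The support of a nonzero one-cycle contains a simple cycle. -/
lemma exists_simpleCycle {f : FreeGroup α →* Q} {c : α × Q →₀ ℤ} (hc : bdry f c = 0)
    (hc0 : c ≠ 0) : ∃ l e, SimpleCycle f c l e := by
  classical
  choose! nx hnx1 hnx2 using fun e (he : c e ≠ 0) => exists_next hc he
  obtain ⟨e0, he0⟩ := Finsupp.ne_iff.1 hc0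
  let s : ℕ → α × Q := fun t => nx^[t] e0
  have hs : ∀ t, c (s t) ≠ 0 := by
    intro t
    induction t with
    | zero => exact he0
    | succ t ih =>
      show c (nx^[t + 1] e0) ≠ 0
      rw [Function.iterate_succ_apply']
      exact hnx1 _ ih
  have hsn : ∀ t, otail f c (s (t + 1)) = ohead f c (s t) := by
    intro t
    show otail f c (nx^[t + 1] e0) = _
    rw [Function.iterate_succ_apply']
    exact hnx2 _ (hs t)
  have hex : ∃ l, 0 < l ∧ ∃ i, otail f c (s i) = otail f c (s (i + l)) := by
    obtain ⟨x, y, hxy, h⟩ := Finite.exists_ne_map_eq_of_infinite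
      (fun t => (⟨s t, Finsupp.mem_support_iff.2 (hs t)⟩ : c.support))
    have h : s x = s y := congrArg Subtype.val h
    rcases lt_or_gt_of_ne hxy with hlt | hlt
    · exact ⟨y - x, by omega, x, by rw [h, Nat.add_sub_of_le hlt.le]⟩
    · exact ⟨x - y, by omega, y, by rw [← h, Nat.add_sub_of_le hlt.le]⟩
  obtain ⟨hl, i, hi⟩ := Nat.find_spec hex
  have hmin := fun l hl => Nat.find_min hex (m := l) hl
  set l := Nat.find hex
  have hinj : ∀ x y, x < y → y < l → otail f c (s (i + x)) ≠ otail f c (s (i + y)) := by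
    intro x y hxy hy h
    exact hmin (y - x) (by omega) ⟨by omega, i + x, by rw [h]; congr 2; omega⟩
  refine ⟨l, fun t => s (i + t % l), hl, fun t => by simp, fun t => hs _, fun t => ?_, ?_⟩
  · show otail f c (s (i + (t + 1) % l)) = ohead f c (s (i + t % l))
    rw [← hsn]
    have h1 := Nat.mod_lt t hl
    rw [← Nat.mod_add_mod]
    rcases Nat.lt_or_ge (t % l + 1) l with h | h
    · rw [Nat.mod_eq_of_lt h, add_assoc]
    · rw [show t % l + 1 = l by omega, Nat.mod_self, add_zero, hi, add_assoc,
        show t % l + 1 = l by omega]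
  · intro x hx y hy h
    simp only [Nat.mod_eq_of_lt hx, Nat.mod_eq_of_lt hy] at h
    rcases lt_trichotomy x y with h1 | h1 | h1
    · exact absurd h (hinj x y h1 hy)
    · exact h1
    · exact absurd h.symm (hinj y x h1 hx)

namespace SimpleCycle

variable {f : FreeGroup α →* Q} {c : α × Q →₀ ℤ} {l : ℕ} {e : ℕ → α × Q}

lemma rotate (H : SimpleCycle f c l e) (k : ℕ) : SimpleCycle f c l fun t => e (k + t) := by
  have hmod : ∀ t, e t = e (t % l) := fun t =>
    ((show Function.Periodic e l from H.period).map_mod_nat t).symm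
  refine ⟨H.pos, fun t => by rw [← add_assoc, H.period], fun t => H.ne_zero _,
    fun t => H.next _, fun x hx y hy h => ?_⟩
  rw [hmod (k + x), hmod (k + y)] at h
  have h2 : k + x ≡ k + y [MOD l] :=
    H.inj _ (Nat.mod_lt _ H.pos) _ (Nat.mod_lt _ H.pos) h
  have h3 : x % l = y % l := Nat.ModEq.add_left_cancel' k h2
  rwa [Nat.mod_eq_of_lt hx, Nat.mod_eq_of_lt hy] at h3

lemma map_path (H : SimpleCycle f c l e) (t : ℕ) :
    f (path (fun t => oletter c (e t)) t) = (otail f c (e 0))⁻¹ * otail f c (e t) := by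
  induction t with
  | zero => simp
  | succ t ih => rw [path_succ, map_mul, ih, H.next, ohead, mul_assoc]

lemma map_path_length (H : SimpleCycle f c l e) :
    f (path (fun t => oletter c (e t)) l) = 1 := by
  have := H.period 0
  rw [zero_add] at this
  rw [H.map_path, this, inv_mul_cancel]

lemma edge_path (H : SimpleCycle f c l e) {q : Q} (hq : q = otail f c (e 0)) (t : ℕ) :
    edge f (q * f (path (fun t => oletter c (e t)) t)) (oletter c (e t)) = e t := by
  rw [hq, H.map_path, mul_inv_cancel_left, edge_otail]

lemma e_inj (H : SimpleCycle f c l e) {s t : ℕ} (hs : s < l) (ht : t < l) (h : e s = e t) :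
    s = t := H.inj s hs t ht (by rw [h])

lemma lseq_inj (H : SimpleCycle f c l e) : ∀ i < l, ∀ j < l,
    (lseq f (fun t => oletter c (e t)) i).1 = (lseq f (fun t => oletter c (e t)) j).1 → i = j := by
  intro i hi j hj h
  refine H.e_inj hi hj ?_
  rw [← H.edge_path rfl i, ← H.edge_path rfl j, mul_edge, mul_edge f _ (f (path _ j))]
  exact congrArg (fun p : α × Q => (p.1, otail f c (e 0) * p.2)) h

end SimpleCycle

/-- The chain of a conjugate of a loop. -/
lemma chain_conj_path (f : FreeGroup α →* Q) (g : FreeGroup α) {b : ℕ → α × Bool} {l : ℕ}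
    (h : f (path b l) = 1) : chain f (g * path b l * g⁻¹) =
      ∑ t ∈ Finset.range l, Finsupp.single (edge f (f (g * path b t)) (b t)) (sgn (b t).2) := by
  have htr : ∀ (q : Q) (p : α × Q) (z : ℤ), tr q (Finsupp.single p z) =
      Finsupp.single (p.1, q * p.2) z := by
    intro q p z
    simp [tr, Prod.map]
  rw [chain_conj f g h, chain_path, map_sum]
  refine Finset.sum_congr rfl fun t _ => ?_
  rw [htr, map_mul, mul_edge]
  rfl

/-- The coefficients of a simple cycle in its chain. -/
lemma SimpleCycle.chain_apply {f : FreeGroup α →* Q} {c : α × Q →₀ ℤ} {l : ℕ} {e : ℕ → α × Q}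
    (H : SimpleCycle f c l e) {g : FreeGroup α} (hg : f g = otail f c (e 0)) :
    chain f (g * path (fun t => oletter c (e t)) l * g⁻¹) (e 0) = sgn (oletter c (e 0)).2 := by
  rw [chain_conj_path f g H.map_path_length, Finsupp.finsetSum_apply, Finset.sum_eq_single 0]
  · rw [map_mul, H.edge_path hg, Finsupp.single_eq_same]
  · intro t ht ht0
    rw [map_mul, H.edge_path hg]
    exact Finsupp.single_eq_of_ne fun h =>
      ht0 (H.e_inj (Finset.mem_range.1 ht) H.pos h.symm)
  · intro h
    exact absurd (Finset.mem_range.2 H.pos) h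

lemma SimpleCycle.chain_apply_eq_zero {f : FreeGroup α →* Q} {c : α × Q →₀ ℤ} {l : ℕ}
    {e : ℕ → α × Q} (H : SimpleCycle f c l e) {g : FreeGroup α} (hg : f g = otail f c (e 0))
    {x : α × Q} (hx : c x = 0) :
    chain f (g * path (fun t => oletter c (e t)) l * g⁻¹) x = 0 := by
  rw [chain_conj_path f g H.map_path_length, Finsupp.finsetSum_apply]
  refine Finset.sum_eq_zero fun t _ => ?_
  rw [map_mul, H.edge_path hg]
  refine Finsupp.single_eq_of_ne ?_
  rintro rfl
  exact H.ne_zero t hx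

end OneRelator

namespace OneRelator

open Multiplicative

universe u

variable {α Q : Type u} [Group Q]

lemma endpoints_of_lseq {f : FreeGroup α →* Q} {c : α × Q →₀ ℤ} {a : ℕ → α × Bool} {i : ℕ}
    {e : α × Q} (h : (lseq f a i).1 = e) :
    (a i = oletter c e ∧ otail f c e = f (path a i) ∧ ohead f c e = f (path a (i + 1))) ∨
      (oletter c e = inv (a i) ∧ otail f c e = f (path a (i + 1)) ∧
        ohead f c e = f (path a i)) := by
  rw [ohead, path_succ, map_mul]
  have h1 : edge f (f (path a i)) (a i) = edge f (otail f c e) (oletter c e) := by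
    rw [edge_otail]
    exact h
  rcases start_eq h1 with ⟨h2, h3⟩ | ⟨h2, h3, h4⟩
  · exact Or.inl ⟨h2, h3.symm, by rw [h2, h3]⟩
  · exact Or.inr ⟨h2, h3, h4.symm⟩

/-- Following an edge in a covering where the vertices of a path are identified in the same way. -/
lemma follow_step {Q' : Type u} [Group Q'] {f : FreeGroup α →* Q} {f' : FreeGroup α →* Q'}
    {a : ℕ → α × Bool} {n : ℕ} (hst : ∀ x ≤ n, ∀ y ≤ n, f (path a x) = f (path a y) →
      f' (path a x) = f' (path a y)) {c : α × Q →₀ ℤ} {e : α × Q}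
    (he : ∃ i < n, (lseq f a i).1 = e) {h : FreeGroup α} {x : ℕ} (hx : x ≤ n)
    (hxe : f (path a x) = otail f c e) (hh : f' h = f' (path a x)) :
    (∃ i < n, (lseq f' a i).1 = edge f' (f' h) (oletter c e)) ∧
      ∀ y ≤ n, f (path a y) = ohead f c e → f' (h * letter (oletter c e)) = f' (path a y) := by
  obtain ⟨i, hi, hie⟩ := he
  rcases endpoints_of_lseq (c := c) hie with ⟨h1, h2, h3⟩ | ⟨h1, h2, h3⟩
  · have h4 : f' h = f' (path a i) := hh.trans (hst x hx i hi.le (hxe.trans h2))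
    refine ⟨⟨i, hi, by rw [h4, ← h1]; rfl⟩, fun y hy hye => ?_⟩
    rw [map_mul, h4, ← h1, ← map_mul, ← path_succ]
    exact hst _ hi _ hy (h3.symm.trans hye.symm)
  · have h4 : f' h = f' (path a (i + 1)) := hh.trans (hst x hx (i + 1) hi (hxe.trans h2))
    refine ⟨⟨i, hi, by rw [h4, h1, path_succ, map_mul, edge_inv]; rfl⟩, fun y hy hye => ?_⟩
    rw [map_mul, h4, h1, letter_inv, map_inv, path_succ, map_mul, mul_inv_cancel_right]
    exact hst _ hi.le _ hy (h3.symm.trans hye.symm)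

lemma exists_vertex {f : FreeGroup α →* Q} {a : ℕ → α × Bool} {n : ℕ} {c : α × Q →₀ ℤ}
    {e : α × Q} (he : ∃ i < n, (lseq f a i).1 = e) :
    ∃ x ≤ n, f (path a x) = otail f c e := by
  obtain ⟨i, hi, hie⟩ := he
  rcases endpoints_of_lseq (c := c) hie with ⟨-, h2, -⟩ | ⟨-, h2, -⟩
  · exact ⟨i, hi.le, h2.symm⟩
  · exact ⟨i + 1, hi, h2.symm⟩

/-- Following a simple cycle in a covering where the vertices of a path are identified in the same
way. -/
lemma SimpleCycle.follow {Q' : Type u} [Group Q'] {f : FreeGroup α →* Q} {f' : FreeGroup α →* Q'}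
    {a : ℕ → α × Bool} {n : ℕ} (hst : ∀ x ≤ n, ∀ y ≤ n, f (path a x) = f (path a y) →
      f' (path a x) = f' (path a y)) {c : α × Q →₀ ℤ} {l : ℕ} {e : ℕ → α × Q}
    (H : SimpleCycle f c l e) (he : ∀ t, ∃ i < n, (lseq f a i).1 = e t) {g : FreeGroup α} {x : ℕ}
    (hx : x ≤ n) (hxe : f (path a x) = otail f c (e 0)) (hg : f' g = f' (path a x)) (t : ℕ) :
    ∀ y ≤ n, f (path a y) = otail f c (e t) →
      f' (g * path (fun t => oletter c (e t)) t) = f' (path a y) := by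
  induction t with
  | zero =>
    intro y hy hye
    rw [path_zero, mul_one, hg]
    exact hst _ hx _ hy (hxe.trans hye.symm)
  | succ t ih =>
    intro y hy hye
    obtain ⟨z, hz, hze⟩ := exists_vertex (c := c) (he t)
    rw [path_succ, ← mul_assoc]
    exact (follow_step hst (he t) hz hze (ih z hz hze)).2 y hy (hye.trans (H.next t))

section follow

variable {Q' : Type u} [Group Q'] {f : FreeGroup α →* Q} {f' : FreeGroup α →* Q'}
    {a : ℕ → α × Bool} {n : ℕ} {c : α × Q →₀ ℤ} {l : ℕ} {e : ℕ → α × Q}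

lemma SimpleCycle.map_path_of_stable (H : SimpleCycle f c l e)
    (hst : ∀ x ≤ n, ∀ y ≤ n, f (path a x) = f (path a y) → f' (path a x) = f' (path a y))
    (he : ∀ t, ∃ i < n, (lseq f a i).1 = e t) :
    f' (path (fun t => oletter c (e t)) l) = 1 := by
  obtain ⟨x, hx, hxe⟩ := exists_vertex (c := c) (he 0)
  have h := H.follow hst he hx hxe rfl l x hx (by rw [hxe, ← H.period 0, zero_add])
  rwa [map_mul, mul_eq_left] at h

/-- A stable word is a power of its cycle up to commutators. -/
lemma SimpleCycle.mem_commutator (H : SimpleCycle f c l e)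
    (hst : ∀ x ≤ n, ∀ y ≤ n, f (path a x) = f (path a y) → f' (path a x) = f' (path a y))
    (he : ∀ t, ∃ i < n, (lseq f a i).1 = e t) {π : Q' →* Q} (hπ : π.comp f' = f)
    (hf' : Function.Surjective f') {g : FreeGroup α} {x : ℕ}
    (hx : x ≤ n) (hxe : f (path a x) = otail f c (e 0)) (hg : f' g = f' (path a x))
    (hw : f' (path a n) = 1) {k : ℕ}
    (hk : chain f (path a n) =
      k • chain f (g * path (fun t => oletter c (e t)) l * g⁻¹)) :
    ((g * path (fun t => oletter c (e t)) l * g⁻¹) ^ k)⁻¹ * path a n ∈ ⁅f'.ker, f'.ker⁆ := by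
  have hρ := H.map_path_of_stable hst he
  have hch := chain_conj_path f' g hρ
  set ρ := path (fun t => oletter c (e t)) l
  have hr' : f' (g * ρ * g⁻¹) = 1 := by rw [map_mul, map_mul, hρ, map_inv]; group
  have hr : f (g * ρ * g⁻¹) = 1 := by rw [← hπ, MonoidHom.comp_apply, hr', map_one]
  have hrk : f ((g * ρ * g⁻¹) ^ k) = 1 := by rw [map_pow, hr, one_pow]
  have hrk' : f' ((g * ρ * g⁻¹) ^ k) = 1 := by rw [map_pow, hr', one_pow]
  refine mem_commutator_of_chain hf' (by rw [map_mul, map_inv, hrk', hw]; simp) ?_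
  let E : Set (α × Q') := {y | ∃ i < n, (lseq f' a i).1 = y}
  have hinj : Set.InjOn (edgeMap π) E := by
    rintro _ ⟨i, hi, rfl⟩ _ ⟨j, hj, rfl⟩ h
    have hmap : ∀ i, edgeMap π (lseq f' a i).1 = (lseq f a i).1 := by
      intro i
      subst hπ
      show ((a i).1, π (if (a i).2 then _ else _)) = ((a i).1, if (a i).2 then _ else _)
      rw [apply_ite π, map_mul]
      rfl
    rw [hmap, hmap] at h
    rcases start_eq h with ⟨h1, h2⟩ | ⟨h1, h2, -⟩
    · show edge f' (f' (path a i)) (a i) = edge f' (f' (path a j)) (a j)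
      rw [h1, hst i hi.le j hj.le h2]
    · show edge f' (f' (path a i)) (a i) = edge f' (f' (path a j)) (a j)
      rw [← map_mul, ← path_succ] at h2
      rw [h1, hst j hj.le (i + 1) hi h2, path_succ, map_mul, edge_inv]
  have h0 : chain f' (((g * ρ * g⁻¹) ^ k)⁻¹ * path a n) =
      chain f' (path a n) - k • chain f' (g * ρ * g⁻¹) := by
    rw [chain_mul_of_ker _ (by rw [map_inv, hrk', inv_one]), chain_inv_of_ker _ hrk',
      chain_pow_of_ker _ hr', neg_add_eq_sub]
  have hsupp : chain f' (((g * ρ * g⁻¹) ^ k)⁻¹ * path a n) ∈ Finsupp.supported ℤ ℤ E := by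
    rw [h0]
    refine Submodule.sub_mem _ ?_ (Submodule.smul_of_tower_mem _ k ?_)
    · rw [chain_path]
      exact Submodule.sum_mem _ fun i hi =>
        Finsupp.single_mem_supported ℤ _ ⟨i, Finset.mem_range.1 hi, rfl⟩
    · rw [hch]
      refine Submodule.sum_mem _ fun t _ => Finsupp.single_mem_supported ℤ _ ?_
      obtain ⟨y, hy, hye⟩ := exists_vertex (c := c) (he t)
      exact (follow_step hst (he t) hy hye (H.follow hst he hx hxe hg t y hy hye)).1
  refine Finsupp.mapDomain_injOn E hinj hsupp (Submodule.zero_mem (Finsupp.supported ℤ ℤ E)) ?_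
  rw [Finsupp.mapDomain_zero, ← chain_comp, hπ, chain_mul_of_ker _ (by rw [map_inv, hrk, inv_one]),
    chain_inv_of_ker _ hrk, chain_pow_of_ker _ hr, hk, neg_add_cancel]

end follow

/-- A nontrivial chain of a word contains a simple cycle close to the base point. -/
lemma exists_short_simpleCycle [DecidableEq α] {f : FreeGroup α →* Q} {a : ℕ → α × Bool} {n : ℕ}
    {c : α × Q →₀ ℤ} (hc : bdry f c = 0) (hc0 : c ≠ 0)
    (hs : ∀ e, c e ≠ 0 → ∃ i < n, (lseq f a i).1 = e) :
    ∃ l e, SimpleCycle f c l e ∧ ∃ x ≤ n, ∃ g, (g = path a x ∨ g = (path a n)⁻¹ * path a x) ∧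
      f (path a x) = otail f c (e 0) ∧
      (g * path (fun t => oletter c (e t)) l * g⁻¹).norm ≤ n := by
  classical
  obtain ⟨l, e, H⟩ := exists_simpleCycle hc hc0
  let I := (Finset.range (n + 1)).filter fun x => ∃ t, f (path a x) = otail f c (e t)
  have hI : ∀ x, x ∈ I ↔ x ≤ n ∧ ∃ t, f (path a x) = otail f c (e t) := by
    simp [I]
  have hIne : I.Nonempty := by
    obtain ⟨x, hx, hxe⟩ := exists_vertex (c := c) (hs _ (H.ne_zero 0))
    exact ⟨x, (hI x).2 ⟨hx, 0, hxe⟩⟩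
  choose i hin hi using fun t => hs _ (H.ne_zero t)
  have hiI : ∀ t, i t ∈ I ∧ i t + 1 ∈ I := by
    intro t
    rw [hI, hI]
    rcases endpoints_of_lseq (c := c) (hi t) with ⟨-, h2, h3⟩ | ⟨-, h2, h3⟩
    · exact ⟨⟨(hin t).le, t, h2.symm⟩, hin t, t + 1, h3.symm.trans (H.next t).symm⟩
    · exact ⟨⟨(hin t).le, t + 1, h3.symm.trans (H.next t).symm⟩, hin t, t, h2.symm⟩
  set x := I.min' hIne
  set y := I.max' hIne
  have hl : l ≤ y - x := by
    have := Finset.card_le_card_of_injOn (s := Finset.range l) (t := Finset.Ico x y) i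
      (fun t _ => Finset.mem_coe.2 (Finset.mem_Ico.2
        ⟨Finset.min'_le _ _ (hiI t).1, Finset.le_max' _ _ (hiI t).2⟩))
      (fun s hs t ht h => H.e_inj (Finset.mem_range.1 (Finset.mem_coe.1 hs))
        (Finset.mem_range.1 (Finset.mem_coe.1 ht)) (by rw [← hi s, ← hi t, h]))
    simpa using this
  have hnorm : ∀ (g : FreeGroup α) (b : ℕ → α × Bool) (N : ℕ), g.norm ≤ N → 2 * N + l ≤ n →
      (g * path b l * g⁻¹).norm ≤ n := by
    intro g b N hg hN
    have h2 := FreeGroup.norm_mul_le (g * path b l) g⁻¹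
    have h3 := FreeGroup.norm_mul_le g (path b l)
    have h4 := norm_path_le b l
    rw [FreeGroup.norm_inv_eq] at h2
    omega
  have hxy : x ≤ y := Finset.min'_le _ _ (Finset.max'_mem _ _)
  obtain ⟨hxn, s, hxs⟩ := (hI x).1 (Finset.min'_mem _ _)
  obtain ⟨hyn, t, hyt⟩ := (hI y).1 (Finset.max'_mem _ _)
  rcases Nat.le_total (x + y) n with h | h
  · exact ⟨l, _, H.rotate s, x, hxn, _, Or.inl rfl, hxs,
      hnorm _ _ x (norm_path_le _ _) (by omega)⟩
  · refine ⟨l, _, H.rotate t, y, hyn, _, Or.inr rfl, hyt, hnorm _ _ (n - y) ?_ (by omega)⟩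
    have h2 : path a n = path a y * path (fun i => a (y + i)) (n - y) := by
      rw [← path_add, Nat.add_sub_of_le hyn]
    rw [h2, mul_inv_rev, inv_mul_cancel_right, FreeGroup.norm_inv_eq]
    exact norm_path_le _ _

end OneRelator

namespace OneRelator

open Multiplicative

universe u

variable {α G : Type u} [Group G]

lemma map_mem_ratDerived_of_cov {B : Type u} [Group B] {p : FreeGroup α →* G}
    (hp : Function.Surjective p) {w : FreeGroup α} (hker : p.ker = Subgroup.normalClosure {w})
    {m : ℕ} (ψ : (cov p m).ker →* B) {R : Subgroup (FreeGroup α)} [R.Normal]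
    (hR : R ≤ (cov p m).ker) (hψ : ∀ x : (cov p m).ker, (x : FreeGroup α) ∈ R → ψ x = 1)
    (hw : ∀ i, m ≤ i → w ∈ ⁅(cov p i).ker, (cov p i).ker⁆ ⊔ R) {x : (cov p m).ker}
    (hx : ∀ i, cov p i x = 1) : ψ x ∈ ratDerivedOmega B := by
  refine Subgroup.mem_iInf.2 fun i => map_mem_ratDerived ψ (fun i => (cov p (m + i)).ker) le_rfl
    (fun i j hij g hg => cov_eq_one_of_le (by omega) hg) ?_ i x (hx (m + i))
  intro i g hg
  obtain ⟨k, hk, c, hc, n, hn, h⟩ := exists_pow_of_cov_succ hp hg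
  have hle : Subgroup.normalClosure {w} ≤ ⁅(cov p (m + i)).ker, (cov p (m + i)).ker⁆ ⊔ R :=
    Subgroup.normalClosure_le_normal (Set.singleton_subset_iff.2 (hw _ (by omega)))
  rw [hker] at hn
  obtain ⟨y, hy, z, hz, rfl⟩ := Subgroup.mem_sup_of_normal_right.1 (hle hn)
  exact ⟨k, hk, c * y, Subgroup.mul_mem _ hc hy, ⟨z, hR hz⟩, hψ _ hz, by rw [h, mul_assoc]⟩

lemma eq_one_of_chain_eq_zero {p : FreeGroup α →* G}
    (hp : Function.Surjective p) {w : FreeGroup α} (hker : p.ker = Subgroup.normalClosure {w})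
    (h : ∀ i, chain (cov p i) w = 0) {x : FreeGroup α} (hx : ∀ i, cov p i x = 1) : x = 1 := by
  have hw : w ∈ p.ker := hker ▸ Subgroup.subset_normalClosure (Set.mem_singleton w)
  have h1 := map_mem_ratDerived_of_cov hp hker (cov p 0).ker.subtype (R := ⊥) bot_le
    (fun x hx => hx) (fun i _ => Subgroup.mem_sup_left (mem_commutator_of_chain
      (cov_surjective hp i) (cov_eq_one.2 (by rw [show p w = 1 from hw]; exact Subgroup.one_mem _))
      (h i))) (x := ⟨x, hx 0⟩) hx
  rw [ratDerivedOmega_freeGroup] at h1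
  exact h1

/-- A multiple of a simple cycle. -/
lemma SimpleCycle.exists_smul_eq {p : FreeGroup α →* G} (hp : Function.Surjective p)
    {w : FreeGroup α} (hker : p.ker = Subgroup.normalClosure {w}) {m l : ℕ}
    {e : ℕ → α × (G ⧸ ratDerived G m)} (H : SimpleCycle (cov p m) (chain (cov p m) w) l e)
    {g : FreeGroup α} (hg : cov p m g = otail (cov p m) (chain (cov p m) w) (e 0))
    (hρ : cov p (m + 1) (path (fun t => oletter (chain (cov p m) w) (e t)) l) = 1) :
    ∃ k : ℕ, 1 ≤ k ∧ chain (cov p m) w = k • chain (cov p m)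
      (g * path (fun t => oletter (chain (cov p m) w) (e t)) l * g⁻¹) := by
  have hw : w ∈ p.ker := hker ▸ Subgroup.subset_normalClosure (Set.mem_singleton w)
  have hw1 : cov p m w = 1 :=
    cov_eq_one.2 (by rw [show p w = 1 from hw]; exact Subgroup.one_mem _)
  have hr1 := H.chain_apply hg
  have hr0 := fun x => H.chain_apply_eq_zero hg (x := x)
  have hr : cov p (m + 1) (g * path (fun t => oletter (chain (cov p m) w) (e t)) l * g⁻¹) = 1 := by
    rw [map_mul, map_mul, hρ, map_inv]; group
  have hne := H.ne_zero 0
  set r := g * path (fun t => oletter (chain (cov p m) w) (e t)) l * g⁻¹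
  set c := chain (cov p m) w with hc
  have hrm : cov p m r = 1 := cov_eq_one_of_le (Nat.le_succ m) hr
  obtain ⟨k, hk, d, hd, n, hn, h⟩ := exists_pow_of_cov_succ hp hr
  have h2 : k • chain (cov p m) r = chain (cov p m) n := by
    have hd1 : cov p m d = 1 := Subgroup.commutator_le_left _ _ hd
    rw [← chain_pow_of_ker _ hrm, h, chain_mul_of_ker _ hd1, chain_eq_zero_of_mem _ hd, zero_add]
  rw [hker] at hn
  obtain ⟨z, hz⟩ := (locInd_quotient m).eq_smul_of_support_subset (x := c)
    (y := k • chain (cov p m) r) (by rw [h2]; exact chain_mem_span _ hw1 hn)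
    (fun x hx => by rw [Finsupp.smul_apply, hr0 x hx, smul_zero])
  have hze := DFunLike.congr_fun hz (e 0)
  rw [Finsupp.smul_apply, Finsupp.smul_apply, hr1, nsmul_eq_mul, smul_eq_mul] at hze
  have hsgn : c (e 0) = (c (e 0)).natAbs * sgn (oletter c (e 0)).2 := by
    by_cases h : 0 < c (e 0)
    · simp [sgn, oletter, h, abs_of_pos h]
    · simp [sgn, oletter, h, abs_of_nonpos (not_lt.1 h)]
  have hs0 : sgn (oletter c (e 0)).2 ≠ 0 := by
    intro h
    rw [h, mul_zero] at hsgn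
    exact hne hsgn
  have hk0 : (k : ℤ) = z * (c (e 0)).natAbs := by
    refine mul_right_cancel₀ hs0 ?_
    rw [hze, mul_assoc, ← hsgn]
  have hz0 : z ≠ 0 := by
    rintro rfl
    rw [zero_mul] at hk0
    omega
  refine ⟨(c (e 0)).natAbs, Int.natAbs_pos.2 hne, ?_⟩
  refine smul_right_injective _ hz0 ?_
  show z • c = z • _
  rw [← hz, ← natCast_zsmul, hk0, mul_smul, natCast_zsmul]

/-- The structure of the rational derived series of a one-relator group: its intersection is the
normal closure of a root of the relator up to commutators, and the series eventually consists of
extensions of free groups by that intersection. -/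
theorem exists_root [DecidableEq α] {p : FreeGroup α →* G} (hp : Function.Surjective p)
    {w : FreeGroup α} (hker : p.ker = Subgroup.normalClosure {w}) :
    ∃ (r : FreeGroup α) (k m : ℕ), 1 ≤ k ∧ r.norm ≤ w.norm ∧
      (r ^ k)⁻¹ * w ∈ ⁅Subgroup.normalClosure {r}, Subgroup.normalClosure {r}⁆ ∧
      (∀ x, p x ∈ ratDerivedOmega G ↔ x ∈ Subgroup.normalClosure {r}) ∧
      ∃ (X : Type u) (ψ : (cov p m).ker →* FreeGroup X),
        ∀ x, ψ x = 1 ↔ (x : FreeGroup α) ∈ Subgroup.normalClosure {r} := by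
  have hw : w ∈ p.ker := hker ▸ Subgroup.subset_normalClosure (Set.mem_singleton w)
  have hwc : ∀ i, cov p i w = 1 := fun i =>
    cov_eq_one.2 (by rw [show p w = 1 from hw]; exact Subgroup.one_mem _)
  have homega : ∀ x, p x ∈ ratDerivedOmega G ↔ ∀ i, cov p i x = 1 := by
    intro x
    rw [ratDerivedOmega, Subgroup.mem_iInf]
    exact forall_congr' fun i => cov_eq_one.symm
  by_cases hzero : ∀ i, chain (cov p i) w = 0
  · have hw1 : w = 1 := eq_one_of_chain_eq_zero hp hker hzero hwc
    subst hw1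
    have hbot : Subgroup.normalClosure {(1 : FreeGroup α)} = ⊥ :=
      le_bot_iff.1 (Subgroup.normalClosure_le_normal (by simp))
    refine ⟨1, 1, 0, le_rfl, le_rfl, by simp, fun x => ?_, α, (cov p 0).ker.subtype, fun x => ?_⟩
    · rw [homega, hbot, Subgroup.mem_bot]
      exact ⟨eq_one_of_chain_eq_zero hp hker hzero, by rintro rfl; simp⟩
    · rw [hbot, Subgroup.mem_bot]
      rfl
  push Not at hzero
  obtain ⟨m₀, hm₀⟩ := hzero
  have hL : w.toWord ≠ [] := by
    intro h
    rw [FreeGroup.toWord_eq_nil_iff] at h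
    exact hm₀ (by rw [h, chain_one])
  obtain ⟨a, -, haw, -⟩ := exists_seq_of_list hL
  rw [FreeGroup.mk_toWord] at haw
  have hn : w.norm = w.toWord.length := rfl
  rw [← hn] at haw
  set n := w.norm
  obtain ⟨m₁, hm₁⟩ := exists_stable (Finset.range (n + 1) ×ˢ Finset.range (n + 1))
    (fun m ij => cov p m (path a ij.1) = cov p m (path a ij.2)) (by
      intro ij m m' hmm h
      exact cov_eq_cov.2 (cov_eq_one_of_le hmm (cov_eq_cov.1 h)))
  obtain ⟨m, hmm₀, hmm₁⟩ : ∃ m, m₀ ≤ m ∧ m₁ ≤ m := ⟨max m₀ m₁, le_max_left _ _, le_max_right _ _⟩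
  have hst : ∀ x ≤ n, ∀ y ≤ n, cov p m (path a x) = cov p m (path a y) →
      ∀ m', cov p m' (path a x) = cov p m' (path a y) := by
    intro x hx y hy h
    exact hm₁ (x, y) (by simp; omega) (cov_eq_cov.2 (cov_eq_one_of_le hmm₁ (cov_eq_cov.1 h)))
  have hc0 : chain (cov p m) w ≠ 0 := by
    intro h
    apply hm₀
    have : (QuotientGroup.map _ _ (MonoidHom.id G) (ratDerived_antitone hmm₀)).comp (cov p m) =
      cov p m₀ := rfl
    rw [← this, chain_comp, h, Finsupp.mapDomain_zero]
  have hbd : bdry (cov p m) (chain (cov p m) w) = 0 := by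
    rw [← haw, bdry_chain_path, haw, hwc, sub_self]
  have hsupp : ∀ e, chain (cov p m) w e ≠ 0 → ∃ i < n, (lseq (cov p m) a i).1 = e := by
    intro e he
    by_contra! hne
    rw [← haw, chain_path, Finsupp.finsetSum_apply] at he
    exact he (Finset.sum_eq_zero fun i hi =>
      Finsupp.single_eq_of_ne (hne i (Finset.mem_range.1 hi)).symm)
  obtain ⟨l, e, H, x, hx, g, hg, hxe, hnorm⟩ := exists_short_simpleCycle hbd hc0 hsupp
  have he := fun t => hsupp _ (H.ne_zero t)
  have hgf : ∀ {Q : Type u} [Group Q] (f : FreeGroup α →* Q), f w = 1 → f g = f (path a x) := by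
    intro Q _ f hf
    rcases hg with rfl | rfl
    · rfl
    · rw [haw, map_mul, map_inv, hf, inv_one, one_mul]
  have hρ : ∀ i, cov p i (path (fun t => oletter (chain (cov p m) w) (e t)) l) = 1 := fun i =>
    H.map_path_of_stable (fun x hx y hy h => hst x hx y hy h i) he
  obtain ⟨k, hk, hck⟩ := H.exists_smul_eq hp hker ((hgf _ (hwc m)).trans hxe) (hρ (m + 1))
  have key : ∀ {Q : Type u} [Group Q] (f : FreeGroup α →* Q) (_ : Function.Surjective f)
      (π : Q →* G ⧸ ratDerived G m) (_ : π.comp f = cov p m) (_ : f w = 1)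
      (_ : ∀ x ≤ n, ∀ y ≤ n, cov p m (path a x) = cov p m (path a y) →
        f (path a x) = f (path a y)),
      ((g * path (fun t => oletter (chain (cov p m) w) (e t)) l * g⁻¹) ^ k)⁻¹ * w ∈
        ⁅f.ker, f.ker⁆ := by
    intro Q _ f hf π hπ hfw hfs
    have := H.mem_commutator hfs he hπ hf hx hxe (hgf f hfw) (by rw [haw, hfw])
      (k := k) (by rw [haw]; exact hck)
    rwa [haw] at this
  obtain ⟨ψ, hψ⟩ := exists_hom_ker_eq_normalClosure (locInd_quotient m) (cov_surjective hp m)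
    H.pos H.map_path_length H.lseq_inj
  set ρ := path (fun t => oletter (chain (cov p m) w) (e t)) l
  have hRρ : Subgroup.normalClosure {ρ} = Subgroup.normalClosure {g * ρ * g⁻¹} :=
    normalClosure_eq_of_isConj (isConj_iff.2 ⟨g, rfl⟩)
  rw [hRρ] at hψ
  set r := g * ρ * g⁻¹
  have hr : ∀ i, cov p i r = 1 := fun i => by rw [map_mul, map_mul, hρ, map_inv]; group
  have hwi : ∀ i, m ≤ i →
      w ∈ ⁅(cov p i).ker, (cov p i).ker⁆ ⊔ Subgroup.normalClosure {r} := by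
    intro i hi
    have h1 := key (cov p i) (cov_surjective hp i)
      (QuotientGroup.map _ _ (MonoidHom.id G) (ratDerived_antitone hi)) rfl (hwc i)
      (fun x hx y hy h => hst x hx y hy h i)
    have h2 : r ^ k ∈ Subgroup.normalClosure {r} :=
      Subgroup.pow_mem _ (Subgroup.subset_normalClosure (Set.mem_singleton r)) k
    have h3 := Subgroup.mul_mem _ (Subgroup.mem_sup_right h2) (Subgroup.mem_sup_left h1)
    rwa [mul_inv_cancel_left] at h3
  have hom : ∀ x, p x ∈ ratDerivedOmega G ↔ x ∈ Subgroup.normalClosure {r} := by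
    intro x
    rw [homega]
    refine ⟨fun h => ?_, fun h i => normalClosure_le_ker (hr i) h⟩
    have h1 := map_mem_ratDerived_of_cov hp hker ψ (normalClosure_le_ker (hr m))
      (fun x hx => (hψ x).2 hx) hwi (x := ⟨x, h m⟩) h
    rw [ratDerivedOmega_freeGroup] at h1
    exact (hψ _).1 h1
  refine ⟨r, k, m, hk, hnorm, ?_, hom, _, ψ, hψ⟩
  have hkerω : ((QuotientGroup.mk' (ratDerivedOmega G)).comp p).ker =
      Subgroup.normalClosure {r} := by
    ext x
    rw [← hom]
    exact QuotientGroup.eq_one_iff _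
  rw [← hkerω]
  refine key _ ((QuotientGroup.mk'_surjective _).comp hp)
    (QuotientGroup.map _ _ (MonoidHom.id G) (iInf_le _ m)) rfl ?_ fun x hx y hy h => ?_
  · rw [MonoidHom.comp_apply, show p w = 1 from hw, map_one]
  · have h1 := hst x hx y hy h
    rw [← inv_mul_eq_one, ← map_inv, ← map_mul]
    refine (QuotientGroup.eq_one_iff _).2 ((homega _).2 fun i => ?_)
    exact cov_eq_cov.1 (h1 i)

end OneRelator

namespace OneRelator

universe u

variable {S : Type u}

/-- The terms of the rational derived series are eventually free extensions, hence free when the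
series has trivial intersection. -/
lemma isFreeGroup_ratDerived {G : Type u} [Group G] {p : FreeGroup S →* G}
    (hp : Function.Surjective p) {m : ℕ} {X : Type u} (ψ : (cov p m).ker →* FreeGroup X)
    (hψ : ∀ x, ψ x = 1 ↔ (x : FreeGroup S) ∈ p.ker) : IsFreeGroup (ratDerived G m) := by
  let π : (cov p m).ker →* ratDerived G m :=
    (p.comp (cov p m).ker.subtype).codRestrict _ fun x => cov_eq_one.1 x.2
  have hπ : Function.Surjective π := by
    rintro ⟨y, hy⟩
    obtain ⟨x, rfl⟩ := hp y
    exact ⟨⟨x, cov_eq_one.2 hy⟩, rfl⟩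
  have hker : π.ker = ψ.ker := by
    ext x
    rw [MonoidHom.mem_ker, MonoidHom.mem_ker, hψ]
    exact Subtype.ext_iff
  have := subgroupIsFreeOfIsFree ψ.range
  exact IsFreeGroup.ofMulEquiv ((QuotientGroup.quotientKerEquivRange ψ).symm.trans
    ((QuotientGroup.quotientMulEquivOfEq hker.symm).trans
      (QuotientGroup.quotientKerEquivOfSurjective π hπ)))

lemma residuallyQSolvable_of_isFreeGroup {G : Type u} [Group G] {n : ℕ}
    (h : IsFreeGroup (ratDerived G n)) : ResiduallyQSolvable G := by
  rw [ResiduallyQSolvable, Subgroup.eq_bot_iff_forall]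
  intro x hx
  have hx : ∀ i, x ∈ ratDerived G i := Subgroup.mem_iInf.1 hx
  let ψ := (IsFreeGroup.toFreeGroup (ratDerived G n)).toMonoidHom
  have h1 : ψ ⟨x, hx n⟩ ∈ ratDerivedOmega (FreeGroup (IsFreeGroup.Generators (ratDerived G n))) :=
    Subgroup.mem_iInf.2 fun i => map_mem_ratDerived ψ (fun i => ratDerived G (n + i)) le_rfl
      (fun i j hij => ratDerived_antitone (by omega)) (fun i g hg => by
        obtain ⟨-, k, hk, h⟩ := mem_ratDerived_succ.1 hg
        exact ⟨k, hk, _, h, 1, map_one _, by simp⟩) i ⟨x, hx n⟩ (hx (n + i))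
  rw [ratDerivedOmega_freeGroup, Subgroup.mem_bot] at h1
  have h2 : (⟨x, hx n⟩ : ratDerived G n) = 1 :=
    (IsFreeGroup.toFreeGroup (ratDerived G n)).injective (h1.trans (map_one ψ).symm)
  exact congrArg Subtype.val h2

/-- A root of the relator up to commutators lies in every term of the rational derived series. -/
lemma map_mem_ratDerivedOmega_of_root {G : Type u} [Group G] {p : FreeGroup S →* G}
    {w r : FreeGroup S} (hw : p w = 1) {k : ℕ} (hk : 1 ≤ k)
    (h : (r ^ k)⁻¹ * w ∈ ⁅Subgroup.normalClosure {r}, Subgroup.normalClosure {r}⁆) :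
    p r ∈ ratDerivedOmega G := by
  refine Subgroup.mem_iInf.2 fun i => ?_
  induction i with
  | zero => exact Subgroup.mem_top _
  | succ i ih =>
    refine mem_ratDerived_succ.2 ⟨ih, k, hk, ?_⟩
    have hle : (Subgroup.normalClosure {r}).map p ≤ ratDerived G i := by
      rw [Subgroup.map_le_iff_le_comap]
      exact Subgroup.normalClosure_le_normal (Set.singleton_subset_iff.2 ih)
    have h1 := Subgroup.mem_map_of_mem p h
    rw [Subgroup.map_commutator, map_mul, hw, mul_one, map_inv, map_pow, inv_mem_iff] at h1
    exact Subgroup.commutator_mono hle hle h1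

end OneRelator

/-- For a one-relator group `G = F/⟪w⟫` the following are equivalent:
(1) `G` is residually ℚ-solvable; (2) `D^n(G)` is free for some `n`; (3) whenever
`w ∈ r^k·[⟪r⟫,⟪r⟫]` with `|r| ≤ |w|` and `k ≥ 1`, `w` is conjugate to `r` or `r⁻¹`. -/
theorem residually_QSolvable_oneRelator_tfae {S : Type*} [DecidableEq S] (w : FreeGroup S) :
    (ResiduallyQSolvable (FreeGroup S ⧸ Subgroup.normalClosure {w}) ↔
      ∃ n : ℕ, IsFreeGroup (↥(ratDerived (FreeGroup S ⧸ Subgroup.normalClosure {w}) n))) ∧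
    (ResiduallyQSolvable (FreeGroup S ⧸ Subgroup.normalClosure {w}) ↔
      ∀ (r : FreeGroup S) (k : ℕ),
        r.toWord.length ≤ w.toWord.length → 1 ≤ k →
        (r ^ k)⁻¹ * w ∈ ⁅Subgroup.normalClosure {r}, Subgroup.normalClosure {r}⁆ →
        (IsConj w r ∨ IsConj w r⁻¹)) := by
  have hp := QuotientGroup.mk'_surjective (Subgroup.normalClosure {w})
  have hker := QuotientGroup.ker_mk' (Subgroup.normalClosure {w})
  have hw : QuotientGroup.mk' (Subgroup.normalClosure {w}) w = 1 :=
    (QuotientGroup.eq_one_iff w).2 (Subgroup.subset_normalClosure (Set.mem_singleton w))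
  have hres : ResiduallyQSolvable (FreeGroup S ⧸ Subgroup.normalClosure {w}) ↔
      ∀ x, QuotientGroup.mk' (Subgroup.normalClosure {w}) x ∈ ratDerivedOmega _ →
        x ∈ Subgroup.normalClosure {w} := by
    rw [ResiduallyQSolvable, Subgroup.eq_bot_iff_forall, hp.forall]
    exact forall_congr' fun x => imp_congr_right fun _ => QuotientGroup.eq_one_iff x
  obtain ⟨r, k, m, hk, hlen, hrw, hom, X, ψ, hψ⟩ := OneRelator.exists_root hp hker
  have hwr : Subgroup.normalClosure {w} ≤ Subgroup.normalClosure {r} :=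
    Subgroup.normalClosure_le_normal (Set.singleton_subset_iff.2 ((hom w).1 (by
      rw [hw]; exact Subgroup.one_mem _)))
  refine ⟨⟨fun h => ⟨m, ?_⟩, fun ⟨n, hn⟩ => OneRelator.residuallyQSolvable_of_isFreeGroup hn⟩,
    fun h r' k' _ hk' hr' => ?_, fun h => ?_⟩
  · refine OneRelator.isFreeGroup_ratDerived hp ψ fun x => ?_
    rw [hψ, hker]
    exact ⟨fun hx => hres.1 h _ ((hom _).2 hx), fun hx => hwr hx⟩
  · have h1 := hres.1 h r' (OneRelator.map_mem_ratDerivedOmega_of_root hw hk' hr')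
    refine OneRelator.isConj_of_normalClosure_eq (le_antisymm ?_ ?_)
    · refine Subgroup.normalClosure_le_normal (Set.singleton_subset_iff.2 ?_)
      have h2 := Subgroup.mul_mem _ (Subgroup.pow_mem _ (Subgroup.subset_normalClosure
        (Set.mem_singleton r')) k') (Subgroup.commutator_le_left _ _ hr')
      rwa [mul_inv_cancel_left] at h2
    · exact Subgroup.normalClosure_le_normal (Set.singleton_subset_iff.2 h1)
  · have heq : Subgroup.normalClosure {w} = Subgroup.normalClosure {r} := by
      rcases h r k hlen hk hrw with h | h
      · exact OneRelator.normalClosure_eq_of_isConj h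
      · rw [OneRelator.normalClosure_eq_of_isConj h]
        refine le_antisymm ?_ ?_ <;>
          refine Subgroup.normalClosure_le_normal (Set.singleton_subset_iff.2 ?_)
        · exact Subgroup.inv_mem _ (Subgroup.subset_normalClosure (Set.mem_singleton r))
        · exact (Subgroup.inv_mem_iff _).1 (Subgroup.subset_normalClosure (Set.mem_singleton r⁻¹))
    refine hres.2 fun x hx => ?_
    rw [heq]
    exact (hom x).1 hx
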